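/- Let (X, X̂, X̃) be a metrizable compactification pack, let d be a metric on X̃ inducing its topology, and let ℰ₀ be the C₀ coarse structure on X̂. For every n ∈ ℕ the following are equivalent: (a) dim X ≤ n; (b) asdim(X̂, ℰ₀) ≤ n + 1; (c) for every uniform cover β of X̂ there is a canonical cover α of (X, X̂, X̃) with β ≺ α and mult α ≤ n + 2; (d) for every canonical cover β of (X, X̂, X̃) there is a canonical cover α with β ≺ α and mult α ≤ n + 2. -/

import Mathlib

open Set Metric Topology Filter

/-- `Δ(α) = ⋃_{U ∈ α} U × U`. -/
def deltaFam {Z : Type*} (α : Set (Set Z)) : Set (Z × Z) := ⋃ U ∈ α, U ×ˢ U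

/-- `E(A) = {y : ∃ x ∈ A, (y, x) ∈ E}`. -/
def eApply {Z : Type*} (E : Set (Z × Z)) (A : Set Z) : Set Z := {y | ∃ x ∈ A, (y, x) ∈ E}

/-- `E⁻¹ = {(y,x) : (x,y) ∈ E}`. -/
def invRel {Z : Type*} (E : Set (Z × Z)) : Set (Z × Z) := {p | (p.2, p.1) ∈ E}

/-- `α(A) = ⋃ {U ∈ α : U ∩ A ≠ ∅}`. -/
def famApply {Z : Type*} (α : Set (Set Z)) (A : Set Z) : Set Z :=
  ⋃₀ {U ∈ α | (U ∩ A).Nonempty}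

/-- `β ≺ α`: every member of `β` is contained in some member of `α`. -/
def Refines {Z : Type*} (β α : Set (Set Z)) : Prop := ∀ V ∈ β, ∃ U ∈ α, V ⊆ U

/-- `mult α ≤ m`: every finite subfamily of `α` with nonempty intersection has
cardinality at most `m`. -/
def MultLE {Z : Type*} (α : Set (Set Z)) (m : ℕ) : Prop :=
  ∀ S : Finset (Set Z), ↑S ⊆ α → (⋂₀ (S : Set (Set Z))).Nonempty → S.card ≤ m

/-- A family `α` is locally finite in `hX`:every point of `hX` has a neighborhood meeting
only finitely many members of `α`. -/
def LocallyFiniteIn {Z : Type*} [TopologicalSpace Z] (hX : Set Z) (α : Set (Set Z)) : Prop :=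
  ∀ x ∈ hX, ∃ V : Set Z, IsOpen V ∧ x ∈ V ∧ {U ∈ α | (U ∩ V).Nonempty}.Finite

/-- Covering dimension at most `n` (an integer; the empty space has dimension `-1`);
for `n ≥ 0` this is the usual condition that every finite open cover admits a finite
open refinement, still covering, of multiplicity at most `n + 1`. -/
def DimLE (Y : Type*) [TopologicalSpace Y] (n : ℤ) : Prop :=
  (IsEmpty Y ∧ -1 ≤ n) ∨
  ∃ m : ℕ, (m : ℤ) = n ∧
    ∀ α : Set (Set Y), α.Finite → (∀ U ∈ α, IsOpen U) → ⋃₀ α = univ →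
      ∃ β : Set (Set Y), β.Finite ∧ (∀ V ∈ β, IsOpen V) ∧ ⋃₀ β = univ ∧
        Refines β α ∧ MultLE β (m + 1)

/-- `E` belongs to the C₀ coarse structure on `hX` (with the metric of the ambient
space): for every `ε > 0` there is a compact `K ⊆ hX` with `dist x y < ε` for every
`(x, y) ∈ E \ (K × K)`. -/
def MemC0 {T : Type*} [MetricSpace T] (hX : Set T) (E : Set (T × T)) : Prop :=
  E ⊆ hX ×ˢ hX ∧
  ∀ ε > 0, ∃ K : Set T, K ⊆ hX ∧ IsCompact K ∧
    ∀ p ∈ E \ K ×ˢ K, dist p.1 p.2 < ε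

/-- A family of subsets of `hX` is uniform if `Δ(α) ∈ ℰ₀`. -/
def IsUniformFam {T : Type*} [MetricSpace T] (hX : Set T) (α : Set (Set T)) : Prop :=
  MemC0 hX (deltaFam α)

/-- A uniform cover of `hX`. -/
def IsUniformCover {T : Type*} [MetricSpace T] (hX : Set T) (α : Set (Set T)) : Prop :=
  IsUniformFam hX α ∧ ⋃₀ α = hX

/-- A canonical cover of the compactification pack `(X, Xᶜ, T)`: an open, locally
finite cover `α` of `X̂ = Xᶜ` such that for every `x ∈ X` and every neighborhood `V`
of `x` there is a neighborhood `W` of `x` with `α(W ∩ X̂) ⊆ V`. -/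
def IsCanonicalCover {T : Type*} [TopologicalSpace T] (X : Set T) (α : Set (Set T)) : Prop :=
  (∀ U ∈ α, IsOpen U ∧ U ⊆ Xᶜ) ∧ ⋃₀ α = Xᶜ ∧ LocallyFiniteIn Xᶜ α ∧
  ∀ x ∈ X, ∀ V ∈ 𝓝 x, ∃ W ∈ 𝓝 x, famApply α (W ∩ Xᶜ) ⊆ V

/-- `asdim (hX, ℰ₀) ≤ m`: every uniform cover admits a uniform coarsening of
multiplicity at most `m + 1`. -/
def AsdimLE {T : Type*} [MetricSpace T] (hX : Set T) (m : ℕ) : Prop :=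
  ∀ β, IsUniformCover hX β → ∃ α, IsUniformCover hX α ∧ Refines β α ∧ MultLE α (m + 1)

/-- `X` is a cylindrical subset of `T`. -/
def IsCylindrical (T : Type*) [TopologicalSpace T] (X : Set T) : Prop :=
  ∃ j : X × unitInterval → T, Topology.IsEmbedding j ∧ ∀ x : X, j (x, 0) = (x : T)

/-- `X` is a Z-set of the metric space `T`. -/
def IsZSet {T : Type*} [MetricSpace T] (X : Set T) : Prop :=
  IsClosed X ∧ ∀ ε > 0, ∃ f : T → T, Continuous f ∧ (∀ z, dist (f z) z < ε) ∧
    Set.range f ∩ X = ∅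

/-- Every map into `V` which does not vanish on a closed set can be changed off that set to a
nowhere vanishing map. -/
def HasNonvanishingExt (Y V : Type*) [TopologicalSpace Y] [NormedAddCommGroup V] : Prop :=
  ∀ (F : C(Y, V)) (A : Set Y), IsClosed A → (∀ a ∈ A, F a ≠ 0) →
    ∃ g : C(Y, V), (∀ y, g y ≠ 0) ∧ ∀ a ∈ A, g a = F a

lemma HasNonvanishingExt.exists_shrinking {Y : Type*} [TopologicalSpace Y] [NormalSpace Y]
    {n : ℕ} (H : HasNonvanishingExt Y (Fin (n + 1) → ℝ)) (U : Fin (n + 2) → Set Y)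
    (hU : ∀ i, IsOpen (U i)) (hc : ⋃ i, U i = univ) :
    ∃ V : Fin (n + 2) → Set Y, (∀ i, IsOpen (V i)) ∧ (∀ i, V i ⊆ U i) ∧
      ⋃ i, V i = univ ∧ ⋂ i, V i = ∅ := by
  obtain ⟨p, hp⟩ := PartitionOfUnity.exists_isSubordinate_of_locallyFinite (s := univ)
    isClosed_univ U hU (locallyFinite_of_finite U) hc.ge
  have hsum : ∀ x, ∑ i, p i x = 1 := fun x => by
    rw [← finsum_eq_sum_of_fintype]; exact p.sum_eq_one (mem_univ x)
  have hpU : ∀ i x, p i x ≠ 0 → x ∈ U i := fun i x h => hp i (subset_tsupport _ h)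
  let F : C(Y, Fin (n + 1) → ℝ) := ⟨fun x i => p i.succ x - p 0 x, by fun_prop⟩
  let A : Set Y := ⋃ i, {x | p i x = 0}
  have hA : IsClosed A := isClosed_iUnion_of_finite fun i =>
    isClosed_eq (p i).continuous continuous_const
  obtain ⟨g, hg0, hgA⟩ := H F A hA (by
    intro a ha h0
    obtain ⟨i, hi⟩ := mem_iUnion.1 ha
    have h1 : ∀ j, p j a = p 0 a := by
      intro j
      refine Fin.cases rfl (fun k => ?_) j
      have := congrFun h0 k
      simp only [F, ContinuousMap.coe_mk, Pi.zero_apply] at this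
      linarith
    have h2 : ∀ j, p j a = 0 := fun j => by rw [h1 j, ← h1 i]; exact hi
    simpa [h2] using hsum a)
  let q : Fin (n + 2) → Y → ℝ := fun i x => Fin.cases (p 0 x) (fun j => p 0 x + g x j) i
  have hq : ∀ i, Continuous (q i) := by
    intro i
    refine Fin.cases ?_ (fun j => ?_) i
    · exact (p 0).continuous
    · change Continuous fun x => p 0 x + g x j
      fun_prop
  have hqA : ∀ x ∈ A, ∀ i, q i x = p i x := by
    intro x hx i
    refine Fin.cases rfl (fun j => ?_) i
    change p 0 x + g x j = p j.succ x
    rw [hgA x hx]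
    simp [F]
  refine ⟨fun i => ⋃ j, {x | q j x < q i x}, fun i => isOpen_iUnion fun j =>
    isOpen_lt (hq j) (hq i), ?_, ?_, ?_⟩
  · intro i x hx
    obtain ⟨j, hj⟩ := mem_iUnion.1 hx
    apply hpU
    by_cases hxA : x ∈ A
    · have : q j x < q i x := hj
      rw [hqA x hxA, hqA x hxA] at this
      exact ((p.nonneg j x).trans_lt this).ne'
    · intro h
      exact hxA (mem_iUnion.2 ⟨i, h⟩)
  · rw [eq_univ_iff_forall]
    intro x
    obtain ⟨k, hk⟩ := Function.ne_iff.1 (hg0 x)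
    rcases lt_or_gt_of_ne hk with h | h
    · refine mem_iUnion.2 ⟨0, mem_iUnion.2 ⟨k.succ, ?_⟩⟩
      change p 0 x + g x k < p 0 x
      simp only [Pi.zero_apply] at h
      linarith
    · refine mem_iUnion.2 ⟨k.succ, mem_iUnion.2 ⟨0, ?_⟩⟩
      change p 0 x < p 0 x + g x k
      simp only [Pi.zero_apply] at h
      linarith
  · rw [eq_empty_iff_forall_notMem]
    intro x hx
    obtain ⟨i, -, hi⟩ := Finset.exists_min_image Finset.univ (fun i => q i x) ⟨0, Finset.mem_univ _⟩
    obtain ⟨j, hj⟩ := mem_iUnion.1 (mem_iInter.1 hx i)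
    exact absurd (show q j x < q i x from hj) (not_lt.2 (hi j (Finset.mem_univ _)))

lemma HasNonvanishingExt.exists_shrinking_subset {Y ι : Type*} [TopologicalSpace Y] [NormalSpace Y]
    {n : ℕ} (H : HasNonvanishingExt Y (Fin (n + 1) → ℝ)) (S : Finset ι) (hS : S.card = n + 2)
    (U : ι → Set Y) (hU : ∀ i, IsOpen (U i)) (hc : ⋃ i, U i = univ) :
    ∃ V : ι → Set Y, (∀ i, IsOpen (V i)) ∧ (∀ i, V i ⊆ U i) ∧
      ⋃ i, V i = univ ∧ ⋂ i ∈ S, V i = ∅ := by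
  classical
  let e : S ≃ Fin (n + 2) := S.equivFinOfCardEq hS
  let W : Fin (n + 2) → Set Y := fun k =>
    U (e.symm k) ∪ {x | k = Fin.last _ ∧ ∃ j, j ∉ S ∧ x ∈ U j}
  have hWo : ∀ k, IsOpen (W k) := by
    intro k
    refine (hU _).union ?_
    by_cases hk : k = Fin.last _
    · have : {x | k = Fin.last _ ∧ ∃ j, j ∉ S ∧ x ∈ U j} = ⋃ j, ⋃ _ : j ∉ S, U j := by
        ext x; simp [hk]
      rw [this]
      exact isOpen_iUnion fun j => isOpen_iUnion fun _ => hU j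
    · simp [hk]
  obtain ⟨V, hVo, hVW, hVc, hVe⟩ := H.exists_shrinking W hWo (by
    rw [eq_univ_iff_forall]
    intro x
    obtain ⟨i, hi⟩ := mem_iUnion.1 (hc.ge (mem_univ x))
    by_cases hiS : i ∈ S
    · exact mem_iUnion.2 ⟨e ⟨i, hiS⟩, Or.inl (by simpa using hi)⟩
    · exact mem_iUnion.2 ⟨Fin.last _, Or.inr ⟨rfl, i, hiS, hi⟩⟩)
  refine ⟨fun j => if hj : j ∈ S then U j ∩ V (e ⟨j, hj⟩) else U j ∩ V (Fin.last _), ?_, ?_, ?_, ?_⟩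
  · intro i
    dsimp only
    split_ifs <;> exact (hU _).inter (hVo _)
  · intro i
    dsimp only
    split_ifs <;> exact inter_subset_left
  · rw [eq_univ_iff_forall]
    intro x
    obtain ⟨k, hk⟩ := mem_iUnion.1 (hVc.ge (mem_univ x))
    rcases hVW k hk with h | ⟨rfl, j, hjS, hj⟩
    · refine mem_iUnion.2 ⟨e.symm k, ?_⟩
      rw [dif_pos (e.symm k).2]
      exact ⟨h, by simpa using hk⟩
    · refine mem_iUnion.2 ⟨j, ?_⟩
      rw [dif_neg hjS]
      exact ⟨hj, hk⟩
  · rw [eq_empty_iff_forall_notMem]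
    intro x hx
    apply (eq_empty_iff_forall_notMem.1 hVe x)
    refine mem_iInter.2 fun k => ?_
    have := mem_iInter₂.1 hx _ (e.symm k).2
    dsimp only at this
    rw [dif_pos (e.symm k).2] at this
    simpa using this.2

lemma HasNonvanishingExt.exists_shrinking_family {Y ι : Type*} [TopologicalSpace Y] [NormalSpace Y]
    {n : ℕ} (H : HasNonvanishingExt Y (Fin (n + 1) → ℝ)) (𝒮 : Finset (Finset ι))
    (h𝒮 : ∀ S ∈ 𝒮, S.card = n + 2)
    (U : ι → Set Y) (hU : ∀ i, IsOpen (U i)) (hc : ⋃ i, U i = univ) :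
    ∃ V : ι → Set Y, (∀ i, IsOpen (V i)) ∧ (∀ i, V i ⊆ U i) ∧
      ⋃ i, V i = univ ∧ ∀ S ∈ 𝒮, ⋂ i ∈ S, V i = ∅ := by
  classical
  induction 𝒮 using Finset.induction_on with
  | empty => exact ⟨U, hU, fun _ => Subset.rfl, hc, by simp⟩
  | insert S 𝒮 _ ih =>
    obtain ⟨V, hVo, hVU, hVc, hVe⟩ := ih fun S hS => h𝒮 S (Finset.mem_insert_of_mem hS)
    obtain ⟨W, hWo, hWV, hWc, hWe⟩ := H.exists_shrinking_subset S
      (h𝒮 S (Finset.mem_insert_self _ _)) V hVo hVc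
    refine ⟨W, hWo, fun i => (hWV i).trans (hVU i), hWc, ?_⟩
    intro S' hS'
    rcases Finset.mem_insert.1 hS' with rfl | h
    · exact hWe
    · exact subset_empty_iff.1 ((iInter₂_mono fun i _ => hWV i).trans (hVe S' h).subset)

lemma HasNonvanishingExt.dimLE {Y : Type*} [TopologicalSpace Y] [NormalSpace Y]
    {n : ℕ} (H : HasNonvanishingExt Y (Fin (n + 1) → ℝ)) : DimLE Y (n : ℤ) := by
  classical
  refine Or.inr ⟨n, rfl, fun α hfin hα hc => ?_⟩
  have : Fintype α := hfin.fintype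
  obtain ⟨V, hVo, hVU, hVc, hVe⟩ := H.exists_shrinking_family
    (Finset.univ.powersetCard (n + 2)) (fun S hS => (Finset.mem_powersetCard.1 hS).2)
    (fun U : α => (U : Set Y)) (fun U => hα U U.2) (by rwa [← sUnion_eq_iUnion])
  refine ⟨range V, finite_range V, by rintro _ ⟨i, rfl⟩; exact hVo i, by rwa [sUnion_range],
    by rintro _ ⟨i, rfl⟩; exact ⟨i, i.2, hVU i⟩, ?_⟩
  intro S hS hne
  by_contra hlt
  obtain ⟨S', hS'S, hcard⟩ := Finset.exists_subset_card_eq (show n + 2 ≤ S.card by omega)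
  have hch : ∀ W : S', ∃ i, V i = W := fun W => hS (hS'S W.2)
  choose f hf using hch
  have hinj : Function.Injective f := fun a b h => Subtype.ext (by rw [← hf a, ← hf b, h])
  have := hVe (Finset.univ.map ⟨f, hinj⟩) (by simp [Finset.mem_powersetCard, hcard])
  obtain ⟨x, hx⟩ := hne
  refine eq_empty_iff_forall_notMem.1 this x (mem_iInter₂.2 fun i hi => ?_)
  obtain ⟨W, -, rfl⟩ := Finset.mem_map.1 hi
  change x ∈ V (f W)
  rw [hf W]
  exact hx _ (hS'S W.2)

lemma IsCanonicalCover.isUniformCover {T : Type*} [MetricSpace T] [CompactSpace T] {X : Set T}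
    {α : Set (Set T)} (h : IsCanonicalCover X α) : IsUniformCover Xᶜ α := by
  obtain ⟨hα, hc, -, hW⟩ := h
  refine ⟨⟨?_, fun ε hε => ?_⟩, hc⟩
  · rintro p hp
    obtain ⟨U, hU, hpU⟩ := mem_iUnion₂.1 hp
    exact ⟨(hα U hU).2 hpU.1, (hα U hU).2 hpU.2⟩
  choose! W hWn hWb using fun x hx => hW x hx (ball x (ε / 2)) (ball_mem_nhds _ (by positivity))
  have hG : IsOpen (⋃ x ∈ X, interior (W x)) := isOpen_biUnion fun x _ => isOpen_interior
  refine ⟨(⋃ x ∈ X, interior (W x))ᶜ, ?_, hG.isClosed_compl.isCompact, ?_⟩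
  · exact compl_subset_compl.2 fun x hx =>
      mem_iUnion₂.2 ⟨x, hx, mem_interior_iff_mem_nhds.2 (hWn x hx)⟩
  · rintro ⟨p, q⟩ ⟨hpq, hK⟩
    obtain ⟨U, hU, hp, hq⟩ := mem_iUnion₂.1 hpq
    have key : ∀ z ∈ U, z ∈ ⋃ x ∈ X, interior (W x) → dist p q < ε := by
      intro z hz hzG
      obtain ⟨x, hx, hzx⟩ := mem_iUnion₂.1 hzG
      have hsub : U ⊆ ball x (ε / 2) := fun y hy =>
        hWb x hx ⟨U, ⟨hU, z, hz, interior_subset hzx, (hα U hU).2 hz⟩, hy⟩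
      have h1 := hsub hp
      have h2 := hsub hq
      rw [mem_ball] at h1 h2
      linarith [dist_triangle_right p q x]
    by_contra hlt
    exact hK ⟨fun h => hlt (key p hp h), fun h => hlt (key q hq h)⟩

/-- The points all of whose nearest points in `X` belong to `U`. -/
def tubeLift {T : Type*} [MetricSpace T] (X : Set T) (U : Set X) : Set T :=
  {z | ∀ p : X, dist z p ≤ infDist z X → p ∈ U}

lemma tubeLift_mono {T : Type*} [MetricSpace T] {X : Set T} {U V : Set X} (h : U ⊆ V) :
    tubeLift X U ⊆ tubeLift X V := fun _ hz p hp => h (hz p hp)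

lemma exists_dist_eq_infDist {T : Type*} [MetricSpace T] [CompactSpace T] {X : Set T}
    (hX : IsClosed X) (hne : X.Nonempty) (z : T) : ∃ p : X, dist z p = infDist z X := by
  obtain ⟨p, hp, h⟩ := hX.isCompact.exists_infDist_eq_dist hne z
  exact ⟨⟨p, hp⟩, h.symm⟩

lemma isOpen_tubeLift {T : Type*} [MetricSpace T] [CompactSpace T] {X : Set T}
    (hX : IsClosed X) {U : Set X} (hU : IsOpen U) : IsOpen (tubeLift X U) := by
  have : CompactSpace X := isCompact_iff_compactSpace.1 hX.isCompact
  rw [← isClosed_compl_iff]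
  have hcl : IsClosed {q : T × X | dist q.1 q.2 ≤ infDist q.1 X ∧ q.2 ∈ Uᶜ} :=
    (isClosed_le (by fun_prop) ((continuous_infDist_pt X).comp continuous_fst)).inter
      (hU.isClosed_compl.preimage continuous_snd)
  convert isClosedMap_fst_of_compactSpace _ hcl using 1
  ext z
  simp [tubeLift]

lemma MemC0.exists_infDist {T : Type*} [MetricSpace T] {X : Set T}
    (hX : IsClosed X) (hne : X.Nonempty) {E : Set (T × T)} (hE : MemC0 Xᶜ E) {ε : ℝ} (hε : 0 < ε) :
    ∃ δ > 0, ∀ p ∈ E, infDist p.1 X < δ ∨ infDist p.2 X < δ → dist p.1 p.2 < ε := by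
  obtain ⟨K, hKX, hK, h⟩ := hE.2 ε hε
  obtain ⟨δ, hδ, hKδ⟩ : ∃ δ > 0, ∀ z ∈ K, δ ≤ infDist z X := by
    rcases K.eq_empty_or_nonempty with rfl | hKne
    · exact ⟨1, one_pos, by simp⟩
    · obtain ⟨z, hz, hmin⟩ := hK.exists_isMinOn hKne (continuous_infDist_pt X).continuousOn
      exact ⟨_, (hX.notMem_iff_infDist_pos hne).1 (hKX hz), hmin⟩
  refine ⟨δ, hδ, fun p hp hlt => h p ⟨hp, fun hpK => ?_⟩⟩
  rcases hlt with h | h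
  · exact absurd (hKδ _ hpK.1) (not_le.2 h)
  · exact absurd (hKδ _ hpK.2) (not_le.2 h)

lemma IsUniformFam.exists_threshold {T : Type*} [MetricSpace T] {X : Set T}
    (hX : IsClosed X) (hne : X.Nonempty) {β : Set (Set T)} (hβ : IsUniformFam Xᶜ β)
    {x : ℝ} (hx : 0 < x) :
    ∃ y₀ > 0, ∀ y ≤ y₀, ∀ B ∈ β, ∀ z ∈ B, ∀ w ∈ B, infDist z X ≤ y → infDist w X < x := by
  obtain ⟨δ, hδ, h⟩ := MemC0.exists_infDist hX hne hβ (half_pos hx)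
  refine ⟨min (δ / 2) (x / 4), by positivity, fun y hy B hB z hz w hw hzy => ?_⟩
  have h1 := h (w, z) (mem_iUnion₂.2 ⟨B, hB, hw, hz⟩)
    (Or.inr (by dsimp only; linarith [min_le_left (δ / 2) (x / 4)]))
  have h2 := infDist_le_infDist_add_dist (s := X) (x := w) (y := z)
  dsimp only at h1
  linarith [min_le_right (δ / 2) (x / 4)]

lemma IsUniformFam.exists_tubeLift {T : Type*} [MetricSpace T] [CompactSpace T] {X : Set T}
    (hX : IsClosed X) (hne : X.Nonempty) {β : Set (Set T)} (hβ : IsUniformFam Xᶜ β)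
    {𝒰 : Set (Set X)} (ho : ∀ U ∈ 𝒰, IsOpen U) (hc : ⋃₀ 𝒰 = univ) :
    ∃ y₀ > 0, ∀ B ∈ β, (∀ z ∈ B, infDist z X < y₀) → ∃ U ∈ 𝒰, B ⊆ tubeLift X U := by
  have : CompactSpace X := isCompact_iff_compactSpace.1 hX.isCompact
  obtain ⟨r, hr, hrU⟩ := lebesgue_number_lemma_of_metric_sUnion isCompact_univ ho hc.ge
  obtain ⟨δ, hδ, h⟩ := MemC0.exists_infDist hX hne hβ (show 0 < r / 4 by positivity)
  refine ⟨min δ (r / 4), by positivity, fun B hB hBy => ?_⟩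
  rcases B.eq_empty_or_nonempty with rfl | ⟨z₀, hz₀⟩
  · obtain ⟨U, hU, -⟩ := hrU ⟨_, hne.some_mem⟩ (mem_univ _)
    exact ⟨U, hU, empty_subset _⟩
  obtain ⟨p₀, hp₀⟩ := exists_dist_eq_infDist hX hne z₀
  obtain ⟨U, hU, hpU⟩ := hrU p₀ (mem_univ _)
  refine ⟨U, hU, fun z hz p hp => hpU ?_⟩
  have h1 := h (z, z₀) (mem_iUnion₂.2 ⟨B, hB, hz, hz₀⟩)
    (Or.inl ((hBy z hz).trans_le (min_le_left _ _)))
  have h2 := (hBy z hz).trans_le (min_le_right _ _)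
  have h3 := (hBy z₀ hz₀).trans_le (min_le_right _ _)
  have h4 : dist (p : T) p₀ ≤ dist (p : T) z + dist z z₀ + dist z₀ p₀ := dist_triangle4 _ _ _ _
  rw [dist_comm (p : T) z] at h4
  rw [mem_ball, Subtype.dist_eq]
  dsimp only at h1
  linarith

/-- A sequence of finite open covers of `X`, each refining the previous one, together with a
decreasing sequence of heights at which the members of the covers are dropped one at a time. -/
structure TubeScheme {T : Type*} [MetricSpace T] (X : Set T) (β : Set (Set T)) where
  cov : ℕ → Set (Set X)
  par : ℕ → Set X → Set X
  start : ℕ → ℕ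
  pos : ℕ → Set X → ℕ
  height : ℕ → ℝ
  cov_zero : cov 0 = {univ}
  cov_finite : ∀ k, (cov k).Finite
  cov_isOpen : ∀ k, ∀ U ∈ cov k, IsOpen U
  cov_sUnion : ∀ k, ⋃₀ cov k = univ
  cov_dist : ∀ k, ∀ U ∈ cov (k + 1), ∀ x ∈ U, ∀ y ∈ U, dist x y ≤ 1 / (k + 1)
  par_mem : ∀ k, ∀ V ∈ cov (k + 1), par k V ∈ cov k
  subset_par : ∀ k, ∀ V ∈ cov (k + 1), V ⊆ par k V
  start_zero : start 0 = 0
  start_ge : ∀ k, 2 * k ≤ start k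
  start_succ : ∀ k, start k + 2 ≤ start (k + 1)
  start_le_pos : ∀ k U, start k ≤ pos k U
  pos_lt : ∀ k, ∀ U ∈ cov k, pos k U + 2 ≤ start (k + 1)
  pos_zero : pos 0 univ = 0
  pos_injOn : ∀ k, InjOn (pos k) (cov k)
  height_pos : ∀ i, 0 < height i
  height_succ_lt : ∀ i, height (i + 1) < height i
  infDist_lt_height : ∀ z, infDist z X < height 0
  height_le : ∀ i, height (i + 1) ≤ 1 / (i + 1)
  height_gap : ∀ i, ∀ B ∈ β, ∀ z ∈ B, ∀ w ∈ B, infDist z X ≤ height (i + 1) → infDist w X < height i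
  height_cov : ∀ i, ∀ k ≤ i + 1, ∀ B ∈ β, (∀ z ∈ B, infDist z X < height (i + 1)) →
    ∃ U ∈ cov k, B ⊆ tubeLift X U

lemma exists_tubeScheme {T : Type*} [MetricSpace T] [CompactSpace T] {X : Set T}
    (hX : IsClosed X) (hne : X.Nonempty) {β : Set (Set T)} (hβ : IsUniformFam Xᶜ β)
    (P : Set (Set X) → Prop)
    (hP : ∀ α : Set (Set X), α.Finite → (∀ U ∈ α, IsOpen U) → ⋃₀ α = univ →
      ∃ γ : Set (Set X), γ.Finite ∧ (∀ V ∈ γ, IsOpen V) ∧ ⋃₀ γ = univ ∧ Refines γ α ∧ P γ) :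
    ∃ S : TubeScheme X β, ∀ k, P (S.cov (k + 1)) := by
  have : CompactSpace X := isCompact_iff_compactSpace.1 hX.isCompact
  have hstep : ∀ (k : ℕ) (α : Set (Set X)), (α.Finite ∧ (∀ U ∈ α, IsOpen U) ∧ ⋃₀ α = univ) →
      ∃ γ : Set (Set X), (γ.Finite ∧ (∀ V ∈ γ, IsOpen V) ∧ ⋃₀ γ = univ) ∧ Refines γ α ∧ P γ ∧
        ∀ U ∈ γ, ∀ x ∈ U, ∀ y ∈ U, dist x y ≤ 1 / ((k : ℝ) + 1) := by
    rintro k α ⟨hf, ho, hc⟩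
    have hr : (0 : ℝ) < 1 / (2 * (k + 1)) := by positivity
    obtain ⟨t, -, htf, ht⟩ := finite_cover_balls_of_compact (isCompact_univ (X := X)) hr
    obtain ⟨γ, h1, h2, h3, h4, h5⟩ := hP
      (image2 (fun U p => U ∩ ball p (1 / (2 * ((k : ℝ) + 1)))) α t)
      (hf.image2 _ htf) (by rintro _ ⟨U, hU, p, -, rfl⟩; exact (ho U hU).inter isOpen_ball) (by
        rw [eq_univ_iff_forall]
        intro x
        obtain ⟨U, hU, hxU⟩ := hc.ge (mem_univ x)
        obtain ⟨p, hp, hxp⟩ := mem_iUnion₂.1 (ht (mem_univ x))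
        exact ⟨_, ⟨U, hU, p, hp, rfl⟩, hxU, hxp⟩)
    refine ⟨γ, ⟨h1, h2, h3⟩, fun V hV => ?_, h5, fun V hV x hx y hy => ?_⟩
    · obtain ⟨_, ⟨U, hU, p, -, rfl⟩, hVU⟩ := h4 V hV
      exact ⟨U, hU, hVU.trans inter_subset_left⟩
    · obtain ⟨_, ⟨U, hU, p, -, rfl⟩, hVU⟩ := h4 V hV
      have hx' := (hVU hx).2
      have hy' := (hVU hy).2
      rw [mem_ball] at hx' hy'
      have : 1 / ((k : ℝ) + 1) = 1 / (2 * (k + 1)) + 1 / (2 * (k + 1)) := by field_simp; ring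
      linarith [dist_triangle_right x y p]
  choose! f hf1 hf2 hf3 hf4 using hstep
  let cov : ℕ → Set (Set X) := fun k => Nat.rec {univ} f k
  have hcov : ∀ k, (cov k).Finite ∧ (∀ V ∈ cov k, IsOpen V) ∧ ⋃₀ cov k = univ := by
    intro k
    induction k with
    | zero => exact ⟨finite_singleton _, by rintro _ rfl; exact isOpen_univ, sUnion_singleton _⟩
    | succ k ih => exact hf1 k _ ih
  choose! par hpar1 hpar2 using fun k => hf2 k _ (hcov k)
  choose! idx hidx1 hidx2 using fun k => (show ∃ g : Set X → ℕ, (∀ U ∈ cov k, g U < (cov k).ncard) ∧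
      InjOn g (cov k) by
    have := (hcov k).1.fintype
    obtain ⟨e⟩ := Fintype.truncEquivFin (cov k) |>.nonempty
    classical
    refine ⟨fun U => if h : U ∈ cov k then e ⟨U, h⟩ else 0, fun U hU => ?_, fun U hU V hV h => ?_⟩
    · dsimp only
      rw [dif_pos hU, ← Nat.card_coe_set_eq, Nat.card_eq_fintype_card]
      exact (e _).2
    · dsimp only at h
      rw [dif_pos hU, dif_pos hV] at h
      simpa using e.injective (Fin.ext h))
  let start : ℕ → ℕ := fun k => Nat.rec 0 (fun k x => x + (cov k).ncard + 2) k
  have hstart : ∀ k, start (k + 1) = start k + (cov k).ncard + 2 := fun k => rfl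
  have hstart2 : ∀ k, 2 * k ≤ start k := by
    intro k
    induction k with
    | zero => exact Nat.zero_le _
    | succ k ih => rw [hstart]; omega
  obtain ⟨D, hD⟩ := (isCompact_range (continuous_infDist_pt X)).bddAbove
  have hD' : ∀ z, infDist z X < max D 0 + 1 := fun z => by
    have := hD (mem_range_self z)
    linarith [le_max_left D 0]
  choose! y₁ hy₁ hy₁' using fun x (hx : (0 : ℝ) < x) => hβ.exists_threshold hX hne hx
  choose y₂ hy₂ hy₂' using fun k => hβ.exists_tubeLift hX hne (hcov k).2.1 (hcov k).2.2
  have hstep2 : ∀ (i : ℕ) (x : ℝ), 0 < x → ∃ y, 0 < y ∧ y < x ∧ y ≤ 1 / ((i : ℝ) + 1) ∧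
      y ≤ y₁ x ∧ ∀ k ≤ i + 1, y ≤ y₂ k := by
    intro i x hx
    obtain ⟨m, hm, hm'⟩ : ∃ m > 0, ∀ k ≤ i + 1, m ≤ y₂ k := by
      obtain ⟨k, -, hk⟩ := Finset.exists_min_image (Finset.range (i + 2)) y₂ ⟨0, by simp⟩
      exact ⟨y₂ k, hy₂ k, fun j hj => hk j (by simp; omega)⟩
    refine ⟨min (x / 2) (min (1 / (i + 1)) (min (y₁ x) m)), ?_, ?_, ?_, ?_, ?_⟩
    · have := hy₁ x hx
      positivity
    · exact (min_le_left _ _).trans_lt (by linarith)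
    · exact (min_le_right _ _).trans (min_le_left _ _)
    · exact (min_le_right _ _).trans ((min_le_right _ _).trans (min_le_left _ _))
    · exact fun k hk => (min_le_right _ _).trans ((min_le_right _ _).trans
        ((min_le_right _ _).trans (hm' k hk)))
  choose! g hg1 hg2 hg3 hg4 hg5 using hstep2
  let b : ℕ → ℝ := fun i => Nat.rec (max D 0 + 1) g i
  have hb : ∀ i, 0 < b i := by
    intro i
    induction i with
    | zero => change (0 : ℝ) < max D 0 + 1; positivity
    | succ i ih => exact hg1 i _ ih
  refine ⟨{
    cov := cov
    par := par
    start := start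
    pos := fun k U => start k + idx k U
    height := b
    cov_zero := rfl
    cov_finite := fun k => (hcov k).1
    cov_isOpen := fun k => (hcov k).2.1
    cov_sUnion := fun k => (hcov k).2.2
    cov_dist := fun k => hf4 k _ (hcov k)
    par_mem := hpar1
    subset_par := hpar2
    start_zero := rfl
    start_ge := hstart2
    start_succ := fun k => by rw [hstart]; omega
    start_le_pos := fun k U => Nat.le_add_right _ _
    pos_lt := fun k U hU => by
      have := hidx1 k U hU
      rw [hstart]
      omega
    pos_zero := by
      have := hidx1 0 univ rfl
      have h1 : (cov 0).ncard = 1 := ncard_singleton _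
      change 0 + _ = 0
      omega
    pos_injOn := fun k U hU V hV h => hidx2 k hU hV (Nat.add_left_cancel h)
    height_pos := hb
    height_succ_lt := fun i => hg2 i _ (hb i)
    infDist_lt_height := hD'
    height_le := fun i => hg3 i _ (hb i)
    height_gap := fun i => hy₁' _ (hb i) _ (hg4 i _ (hb i))
    height_cov := fun i k hk B hB h =>
      hy₂' k B hB fun z hz => (h z hz).trans_le (hg5 i _ (hb i) k hk) }, fun k => hf3 k _ (hcov k)⟩

namespace TubeScheme

variable {T : Type*} [MetricSpace T] {X : Set T} {β : Set (Set T)} (S : TubeScheme X β)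

/-- The member of the coarsening which corresponds to a member of the `k`-th cover. -/
def cell (k : ℕ) (U : Set X) : Set T :=
  tubeLift X U ∩ {z | infDist z X < S.height (S.pos k U)} ∩
    ({z | S.height (S.start (k + 1)) < infDist z X} ∪
      ⋃ V ∈ {V ∈ S.cov (k + 1) | S.par k V = U},
        tubeLift X V ∩ {z | S.height (S.pos (k + 1) V + 1) < infDist z X})

/-- All cells. -/
def cells : Set (Set T) := {A | ∃ k, ∃ U ∈ S.cov k, A = S.cell k U}

lemma height_strictAnti : StrictAnti S.height := strictAnti_nat_of_succ_lt S.height_succ_lt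

lemma start_mono : Monotone S.start :=
  monotone_nat_of_le_succ fun k => by have := S.start_succ k; omega

lemma height_le_one_div {k : ℕ} (hk : 0 < k) {i : ℕ} (hi : k ≤ i) : S.height i ≤ 1 / k := by
  obtain ⟨k, rfl⟩ := Nat.exists_eq_succ_of_ne_zero hk.ne'
  refine (S.height_strictAnti.antitone hi).trans ?_
  simpa using S.height_le k

lemma exists_height_start_lt {ε : ℝ} (hε : 0 < ε) : ∃ N, S.height (S.start N) < ε := by
  obtain ⟨N, hN⟩ := exists_nat_one_div_lt hε
  refine ⟨N + 1, (S.height_le_one_div N.succ_pos ?_).trans_lt (by simpa using hN)⟩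
  have := S.start_ge (N + 1)
  omega

lemma infDist_lt_of_mem_cell {k : ℕ} {U : Set X} {z : T} (hz : z ∈ S.cell k U) :
    infDist z X < S.height (S.start k) :=
  lt_of_lt_of_le hz.1.2 (S.height_strictAnti.antitone (S.start_le_pos k U))

lemma lt_infDist_of_mem_cell {k : ℕ} {U : Set X} {z : T} (hz : z ∈ S.cell k U) :
    S.height (S.start (k + 2)) < infDist z X := by
  rcases hz.2 with h | h
  · exact (S.height_strictAnti.antitone (S.start_mono (Nat.le_succ _))).trans_lt h
  · obtain ⟨V, ⟨hV, -⟩, -, h⟩ := mem_iUnion₂.1 h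
    refine (S.height_strictAnti.antitone ?_).trans_lt h
    have := S.pos_lt (k + 1) V hV
    have e : k + 1 + 1 = k + 2 := rfl
    rw [e] at this
    omega

lemma cell_subset {k : ℕ} {U : Set X} : S.cell k U ⊆ Xᶜ := by
  intro z hz hzX
  have := S.lt_infDist_of_mem_cell hz
  rw [infDist_zero_of_mem hzX] at this
  exact (S.height_pos _).not_gt this

lemma isOpen_cell [CompactSpace T] (hX : IsClosed X) {k : ℕ} {U : Set X} (hU : U ∈ S.cov k) :
    IsOpen (S.cell k U) := by
  have hc : Continuous fun z : T => infDist z X := continuous_infDist_pt X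
  refine ((isOpen_tubeLift hX (S.cov_isOpen k U hU)).inter (isOpen_lt hc continuous_const)).inter
    ((isOpen_lt continuous_const hc).union (isOpen_biUnion fun V hV => ?_))
  exact (isOpen_tubeLift hX (S.cov_isOpen _ V hV.1)).inter (isOpen_lt continuous_const hc)

lemma refines_cells (hX : IsClosed X) (hne : X.Nonempty) (hβ : ⋃₀ β = Xᶜ) :
    Refines β S.cells := by
  classical
  intro B hB
  rcases B.eq_empty_or_nonempty with rfl | ⟨z₀, hz₀⟩
  · exact ⟨_, ⟨0, univ, by rw [S.cov_zero]; rfl, rfl⟩, empty_subset _⟩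
  have hz₀X : z₀ ∈ Xᶜ := hβ ▸ ⟨B, hB, hz₀⟩
  obtain ⟨N, hN⟩ := S.exists_height_start_lt ((hX.notMem_iff_infDist_pos hne).1 hz₀X)
  have hex : ∃ k, ∃ w ∈ B, S.height (S.start (k + 1) - 1) ≤ infDist w X := by
    refine ⟨N, z₀, hz₀, le_trans (S.height_strictAnti.antitone ?_) hN.le⟩
    have := S.start_succ N
    omega
  set k := Nat.find hex with hk
  obtain ⟨w, hw, hwk⟩ := Nat.find_spec hex
  rw [← hk] at hwk
  have hbig : ∀ z ∈ B, S.height (S.start (k + 1)) < infDist z X := by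
    intro z hz
    by_contra hlt
    have h2 := S.start_succ k
    refine (S.height_gap (S.start (k + 1) - 1) B hB z hz w hw ?_).not_ge hwk
    rw [show S.start (k + 1) - 1 + 1 = S.start (k + 1) by omega]
    exact not_lt.1 hlt
  have hsmall : ∀ z ∈ B, infDist z X < S.height (S.start k - 1) := by
    intro z hz
    rcases Nat.eq_zero_or_pos k with h0 | h0
    · rw [h0, S.start_zero]
      exact S.infDist_lt_height z
    · have := Nat.find_min hex (show k - 1 < Nat.find hex by omega)
      push Not at this
      have := this z hz
      rwa [show k - 1 + 1 = k by omega] at this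
  obtain ⟨U, hU, hBU⟩ : ∃ U ∈ S.cov k, B ⊆ tubeLift X U := by
    rcases Nat.eq_zero_or_pos k with h0 | h0
    · rw [h0, S.cov_zero]
      exact ⟨univ, rfl, fun z _ p _ => mem_univ _⟩
    · have h2 := S.start_ge k
      refine S.height_cov (S.start k - 1 - 1) k (by omega) B hB ?_
      rwa [show S.start k - 1 - 1 + 1 = S.start k - 1 by omega]
  by_cases hpos : ∀ z ∈ B, infDist z X < S.height (S.pos k U)
  · exact ⟨_, ⟨k, U, hU, rfl⟩, fun z hz => ⟨⟨hBU hz, hpos z hz⟩, Or.inl (hbig z hz)⟩⟩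
  · push Not at hpos
    obtain ⟨v, hv, hvk⟩ := hpos
    have hlow : ∀ z ∈ B, S.height (S.pos k U + 1) < infDist z X := by
      intro z hz
      by_contra hlt
      exact (S.height_gap _ B hB z hz v hv (not_lt.1 hlt)).not_ge hvk
    obtain ⟨j, hj⟩ : ∃ j, k = j + 1 := by
      refine Nat.exists_eq_succ_of_ne_zero fun h0 => ?_
      rw [h0, S.cov_zero] at hU
      rw [h0, mem_singleton_iff.1 hU, S.pos_zero] at hvk
      exact hvk.not_gt (S.infDist_lt_height v)
    rw [hj] at hU hlow hsmall
    have hU' := S.par_mem j U hU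
    refine ⟨_, ⟨j, _, hU', rfl⟩, fun z hz => ⟨⟨tubeLift_mono (S.subset_par j U hU) (hBU hz), ?_⟩,
      Or.inr (mem_iUnion₂.2 ⟨U, ⟨hU, rfl⟩, hBU hz, hlow z hz⟩)⟩⟩
    refine (hsmall z hz).trans_le (S.height_strictAnti.antitone ?_)
    have := S.pos_lt j _ hU'
    omega

lemma isCanonicalCover_cells [CompactSpace T] (hX : IsClosed X) (hne : X.Nonempty)
    (hβ : ⋃₀ β = Xᶜ) : IsCanonicalCover X S.cells := by
  refine ⟨?_, ?_, ?_, ?_⟩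
  · rintro _ ⟨k, U, hU, rfl⟩
    exact ⟨S.isOpen_cell hX hU, S.cell_subset⟩
  · refine Subset.antisymm ?_ ?_
    · rintro z ⟨_, ⟨k, U, hU, rfl⟩, hz⟩
      exact S.cell_subset hz
    · rw [← hβ]
      rintro z ⟨B, hB, hz⟩
      obtain ⟨A, hA, hBA⟩ := S.refines_cells hX hne hβ B hB
      exact ⟨A, hA, hBA hz⟩
  · intro z hz
    have hz0 := (hX.notMem_iff_infDist_pos hne).1 hz
    obtain ⟨N, hN⟩ := S.exists_height_start_lt (half_pos hz0)
    refine ⟨{w | infDist z X / 2 < infDist w X},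
      isOpen_lt continuous_const (continuous_infDist_pt X), half_lt_self hz0, ?_⟩
    refine ((finite_Iio N).biUnion fun k _ => (S.cov_finite k).image (S.cell k)).subset ?_
    rintro _ ⟨⟨k, U, hU, rfl⟩, w, hw, hwz⟩
    refine mem_iUnion₂.2 ⟨k, ?_, U, hU, rfl⟩
    by_contra hk
    have h1 := S.infDist_lt_of_mem_cell hw
    have h2 := S.height_strictAnti.antitone (S.start_mono (not_lt.1 hk))
    have h3 : infDist z X / 2 < infDist w X := hwz
    linarith
  · intro x hx V hV
    obtain ⟨ε, hε, hεV⟩ := Metric.mem_nhds_iff.1 hV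
    obtain ⟨N, hN⟩ := exists_nat_one_div_lt (show 0 < ε / 4 by positivity)
    have hr : 0 < min (S.height (S.start (N + 2))) (ε / 4) :=
      lt_min (S.height_pos _) (by positivity)
    refine ⟨ball x (min (S.height (S.start (N + 2))) (ε / 4)), ball_mem_nhds _ hr, ?_⟩
    rintro y ⟨_, ⟨⟨k, U, hU, rfl⟩, w, hw, hwx, -⟩, hy⟩
    refine hεV ?_
    rw [mem_ball, lt_min_iff] at hwx
    have hwX : infDist w X ≤ dist w x := infDist_le_dist_of_mem hx
    have hk : N + 1 ≤ k := by
      by_contra hk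
      have h1 := S.lt_infDist_of_mem_cell hw
      have h2 := S.height_strictAnti.antitone (S.start_mono (show k + 2 ≤ N + 2 by omega))
      linarith
    obtain ⟨j, rfl⟩ : ∃ j, k = j + 1 := ⟨k - 1, by omega⟩
    have hj : 1 / ((j : ℝ) + 1) ≤ 1 / ((N : ℝ) + 1) :=
      one_div_le_one_div_of_le (by positivity) (by exact_mod_cast hk)
    have hle : S.height (S.start (j + 1)) ≤ 1 / ((j : ℝ) + 1) := by
      have := S.height_le_one_div j.succ_pos (show j + 1 ≤ S.start (j + 1) by
        have := S.start_ge (j + 1)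
        omega)
      simpa using this
    obtain ⟨p, hp⟩ := exists_dist_eq_infDist hX hne y
    obtain ⟨q, hq⟩ := exists_dist_eq_infDist hX hne w
    have hpq := S.cov_dist j U hU p (hy.1.1 p hp.le) q (hw.1.1 q hq.le)
    have h1 := S.infDist_lt_of_mem_cell hy
    have h2 : dist y w ≤ dist y p + dist (p : T) q + dist (q : T) w := dist_triangle4 _ _ _ _
    rw [dist_comm (q : T) w] at h2
    rw [Subtype.dist_eq] at hpq
    rw [mem_ball]
    linarith [dist_triangle y w x]

lemma mem_cell_cases {k K : ℕ} {U : Set X} {z : T}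
    (hz : z ∈ S.cell k U) (hU : U ∈ S.cov k) (h1 : S.height (S.start (K + 1)) < infDist z X)
    (h2 : infDist z X ≤ S.height (S.start K)) :
    (∃ W ∈ S.cov K, z ∈ tubeLift X W ∧ infDist z X < S.height (S.pos K W) ∧
      S.cell k U = S.cell K W) ∨
    (∃ W ∈ S.cov K, z ∈ tubeLift X W ∧ S.height (S.pos K W + 1) < infDist z X ∧
      S.cell k U = S.cell (K - 1) (S.par (K - 1) W)) := by
  have hlt := S.infDist_lt_of_mem_cell hz
  have hkK : k ≤ K := by
    by_contra hk
    have := S.height_strictAnti.antitone (S.start_mono (show K + 1 ≤ k by omega))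
    linarith
  by_cases hk : k = K
  · subst hk
    exact Or.inl ⟨U, hU, hz.1.1, hz.1.2, rfl⟩
  · have hle := S.height_strictAnti.antitone (S.start_mono (show k + 1 ≤ K by omega))
    rcases hz.2 with h | h
    · have h : S.height (S.start (k + 1)) < infDist z X := h
      linarith
    · obtain ⟨V, ⟨hV, rfl⟩, hzV, h⟩ := mem_iUnion₂.1 h
      have hK : K = k + 1 := by
        by_contra hne
        have h3 := S.height_strictAnti.antitone (S.start_mono (show k + 2 ≤ K by omega))
        have h4 := S.lt_infDist_of_mem_cell hz
        linarith
      subst hK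
      exact Or.inr ⟨V, hV, hzV, h, rfl⟩

lemma multLE_cells [CompactSpace T] (hX : IsClosed X) (hne : X.Nonempty) {n : ℕ}
    (hS : ∀ k, MultLE (S.cov (k + 1)) (n + 1)) : MultLE S.cells (n + 2) := by
  classical
  have hS' : ∀ k, MultLE (S.cov k) (n + 1) := by
    intro k
    cases k with
    | zero =>
      intro F hF _
      rw [S.cov_zero] at hF
      have : F ⊆ {univ} := fun W hW => by simpa using hF hW
      have := Finset.card_le_card this
      rw [Finset.card_singleton] at this
      omega
    | succ k => exact hS k
  rintro F hF ⟨z, hz⟩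
  rcases F.eq_empty_or_nonempty with rfl | ⟨A₀, hA₀⟩
  · simp
  have hzX : z ∈ Xᶜ := by
    obtain ⟨k, U, hU, rfl⟩ := hF hA₀
    exact S.cell_subset (hz _ hA₀)
  obtain ⟨N, hN⟩ := S.exists_height_start_lt ((hX.notMem_iff_infDist_pos hne).1 hzX)
  have hex : ∃ K, S.height (S.start (K + 1)) < infDist z X :=
    ⟨N, (S.height_strictAnti.antitone (S.start_mono (Nat.le_succ _))).trans_lt hN⟩
  set K := Nat.find hex with hK
  have h1 : S.height (S.start (K + 1)) < infDist z X := Nat.find_spec hex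
  have h2 : infDist z X ≤ S.height (S.start K) := by
    rcases Nat.eq_zero_or_pos K with h0 | h0
    · rw [h0, S.start_zero]
      exact (S.infDist_lt_height z).le
    · have := Nat.find_min hex (show K - 1 < Nat.find hex by omega)
      rw [show K - 1 + 1 = K by omega] at this
      exact not_lt.1 this
  let C := (S.cov_finite K).toFinset
  let C₁ := C.filter fun W => z ∈ tubeLift X W ∧ infDist z X < S.height (S.pos K W)
  let C₂ := C.filter fun W => z ∈ tubeLift X W ∧ S.height (S.pos K W + 1) < infDist z X
  have hFsub : F ⊆ C₁.image (S.cell K) ∪ C₂.image fun W => S.cell (K - 1) (S.par (K - 1) W) := by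
    intro A hA
    obtain ⟨k, U, hU, rfl⟩ := hF hA
    rcases S.mem_cell_cases (hz _ hA) hU h1 h2 with ⟨W, hW, h3, h4, h5⟩ | ⟨W, hW, h3, h4, h5⟩
    · rw [h5]
      exact Finset.mem_union_left _ (Finset.mem_image_of_mem _ (by simp [C₁, C, hW, h3, h4]))
    · rw [h5]
      exact Finset.mem_union_right _ (Finset.mem_image.2 ⟨W, by simp [C₂, C, hW, h3, h4], rfl⟩)
  have hun : (C₁ ∪ C₂).card ≤ n + 1 := by
    obtain ⟨p, hp⟩ := exists_dist_eq_infDist hX hne z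
    refine hS' K _ (fun W hW => ?_) ⟨p, fun W hW => ?_⟩
    · rcases Finset.mem_union.1 hW with h | h
      · simpa [C] using (Finset.mem_filter.1 h).1
      · simpa [C] using (Finset.mem_filter.1 h).1
    · rcases Finset.mem_union.1 hW with h | h
      · exact (Finset.mem_filter.1 h).2.1 p hp.le
      · exact (Finset.mem_filter.1 h).2.1 p hp.le
  have hint : (C₁ ∩ C₂).card ≤ 1 := by
    rw [Finset.card_le_one]
    intro W hW V hV
    obtain ⟨hW₁, hW₂⟩ := Finset.mem_inter.1 hW
    obtain ⟨hV₁, hV₂⟩ := Finset.mem_inter.1 hV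
    have hWC : W ∈ S.cov K := by simpa [C] using (Finset.mem_filter.1 hW₁).1
    have hVC : V ∈ S.cov K := by simpa [C] using (Finset.mem_filter.1 hV₁).1
    refine S.pos_injOn K hWC hVC ?_
    have a1 := S.height_strictAnti.lt_iff_gt.1
      ((Finset.mem_filter.1 hW₂).2.2.trans (Finset.mem_filter.1 hV₁).2.2)
    have a2 := S.height_strictAnti.lt_iff_gt.1
      ((Finset.mem_filter.1 hV₂).2.2.trans (Finset.mem_filter.1 hW₁).2.2)
    omega
  have := Finset.card_union_add_card_inter C₁ C₂
  calc F.card ≤ _ := Finset.card_le_card hFsub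
    _ ≤ _ := Finset.card_union_le _ _
    _ ≤ C₁.card + C₂.card := Nat.add_le_add Finset.card_image_le Finset.card_image_le
    _ ≤ n + 2 := by omega

end TubeScheme

lemma MultLE.mono {Z : Type*} {α : Set (Set Z)} {m k : ℕ} (h : MultLE α m) (hmk : m ≤ k) :
    MultLE α k := fun S hS hne => (h S hS hne).trans hmk

lemma Refines.trans {Z : Type*} {α β γ : Set (Set Z)} (h : Refines α β) (h' : Refines β γ) :
    Refines α γ := by
  intro V hV
  obtain ⟨U, hU, hVU⟩ := h V hV
  obtain ⟨W, hW, hUW⟩ := h' U hU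
  exact ⟨W, hW, hVU.trans hUW⟩

lemma multLE_singleton {Z : Type*} (U : Set Z) : MultLE {U} 1 := by
  intro S hS _
  have : S ⊆ {U} := fun W hW => by simpa using hS hW
  simpa using Finset.card_le_card this

lemma isCanonicalCover_singleton_univ {T : Type*} [TopologicalSpace T] :
    IsCanonicalCover (∅ : Set T) {univ} := by
  refine ⟨by simp, by simp, fun x _ => ⟨univ, isOpen_univ, mem_univ x, ?_⟩, by simp⟩
  exact (finite_singleton _).subset fun U hU => hU.1

lemma refines_singleton_univ {Z : Type*} (β : Set (Set Z)) : Refines β {univ} :=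
  fun V _ => ⟨univ, rfl, subset_univ V⟩

lemma DimLE.exists_canonical {T : Type*} [MetricSpace T] [CompactSpace T] {X : Set T}
    (hX : IsClosed X) {n : ℕ} (h : DimLE ↥X (n : ℤ)) {β : Set (Set T)}
    (hβ : IsUniformCover Xᶜ β) :
    ∃ α : Set (Set T), IsCanonicalCover X α ∧ Refines β α ∧ MultLE α (n + 2) := by
  rcases X.eq_empty_or_nonempty with rfl | hne
  · exact ⟨_, isCanonicalCover_singleton_univ, refines_singleton_univ _,
      (multLE_singleton _).mono (by omega)⟩
  rcases h with ⟨h, -⟩ | ⟨m, hm, h⟩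
  · exact (h.false ⟨_, hne.some_mem⟩).elim
  obtain rfl : m = n := by exact_mod_cast hm
  obtain ⟨S, hS⟩ := exists_tubeScheme hX hne hβ.1 (fun γ => MultLE γ (m + 1)) h
  exact ⟨S.cells, S.isCanonicalCover_cells hX hne hβ.2, S.refines_cells hX hne hβ.2,
    S.multLE_cells hX hne hS⟩

lemma IsUniformCover.exists_canonical {T : Type*} [MetricSpace T] [CompactSpace T] {X : Set T}
    (hX : IsClosed X) {β : Set (Set T)} (hβ : IsUniformCover Xᶜ β) :
    ∃ α : Set (Set T), IsCanonicalCover X α ∧ Refines β α := by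
  rcases X.eq_empty_or_nonempty with rfl | hne
  · exact ⟨_, isCanonicalCover_singleton_univ, refines_singleton_univ _⟩
  obtain ⟨S, -⟩ := exists_tubeScheme hX hne hβ.1 (fun _ => True)
    fun α h1 h2 h3 => ⟨α, h1, h2, h3, fun U hU => ⟨U, hU, Subset.rfl⟩, trivial⟩
  exact ⟨S.cells, S.isCanonicalCover_cells hX hne hβ.2, S.refines_cells hX hne hβ.2⟩

section Partition

variable {T : Type*} [MetricSpace T] {X : Set T}

lemma exists_finite_net [CompactSpace T] (hX : IsClosed X) (hnd : IsNowhereDense X) {r : ℝ}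
    (hr : 0 < r) : ∃ F : Set T, F.Finite ∧ F ⊆ Xᶜ ∧ ∀ x ∈ X, ∃ z ∈ F, dist z x ≤ r := by
  have hd : Dense Xᶜ := by
    rw [← interior_eq_empty_iff_dense_compl, ← hX.closure_eq]
    exact hnd
  obtain ⟨F, hF, hFf, hXF⟩ := hX.isCompact.elim_finite_subcover_image (b := Xᶜ)
    (c := fun z => ball z r) (fun _ _ => isOpen_ball) (by
      intro x _
      obtain ⟨z, hz, hxz⟩ := hd.exists_dist_lt x hr
      exact mem_iUnion₂.2 ⟨z, hz, hxz⟩)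
  refine ⟨F, hFf, hF, fun x hx => ?_⟩
  obtain ⟨z, hz, hxz⟩ := mem_iUnion₂.1 (hXF hx)
  exact ⟨z, hz, (by rw [dist_comm]; exact (mem_ball.1 hxz).le)⟩

/-- The points near `x` at scales close to `t` in a sequence of nets. -/
def netPoints (F : ℕ → Set T) (x : T) (t : ℝ) : Set T :=
  {z | ∃ k : ℕ, |t - k| ≤ 1 ∧ z ∈ F k ∧ dist z x ≤ 1 / (k + 1)}

lemma netPoints_nonempty {F : ℕ → Set T} (hF : ∀ k : ℕ, ∀ x ∈ X, ∃ z ∈ F k, dist z x ≤ 1 / (k + 1))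
    {x : T} (hx : x ∈ X) {t : ℝ} (ht : 0 ≤ t) : (netPoints F x t).Nonempty := by
  obtain ⟨z, hz, hzx⟩ := hF ⌊t⌋₊ x hx
  refine ⟨z, ⌊t⌋₊, ?_, hz, hzx⟩
  have h1 := Nat.floor_le ht
  have h2 := Nat.lt_floor_add_one t
  rw [abs_le]
  constructor <;> linarith

lemma isOpen_netPoints_subset {F : ℕ → Set T} (hF : ∀ k, (F k).Finite) (U : Set T) :
    IsOpen {q : T × ℝ | netPoints F q.1 q.2 ⊆ U} := by
  rw [← isClosed_compl_iff]
  have : {q : T × ℝ | netPoints F q.1 q.2 ⊆ U}ᶜ =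
      ⋃ k : ℕ, ({q : T × ℝ | |q.2 - k| ≤ 1} ∩
        ⋃ z ∈ F k \ U, {q : T × ℝ | dist z q.1 ≤ 1 / ((k : ℝ) + 1)}) := by
    ext q
    simp only [netPoints, mem_compl_iff, mem_ofPred_eq, not_subset, mem_iUnion, mem_inter_iff]
    constructor
    · rintro ⟨z, ⟨k, h1, h2, h3⟩, h4⟩
      exact ⟨k, h1, z, ⟨h2, h4⟩, h3⟩
    · rintro ⟨k, h1, z, ⟨h2, h4⟩, h3⟩
      exact ⟨z, ⟨k, h1, h2, h3⟩, h4⟩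
  rw [this]
  refine LocallyFinite.isClosed_iUnion ?_ fun k => ?_
  · rintro ⟨x, t⟩
    refine ⟨{q | q.2 < t + 1}, (isOpen_lt continuous_snd continuous_const).mem_nhds
      (by simp), (finite_Iic ⌈t + 2⌉₊).subset ?_⟩
    rintro k ⟨q, ⟨hq, -⟩, hqt⟩
    have h1 := (abs_le.1 (show |q.2 - k| ≤ 1 from hq)).1
    have h2 : q.2 < t + 1 := hqt
    have h3 := Nat.le_ceil (t + 2)
    have : (k : ℝ) ≤ ⌈t + 2⌉₊ := by linarith
    exact_mod_cast this
  · refine (isClosed_le (by fun_prop) continuous_const).inter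
      (((hF k).subset sdiff_subset).isClosed_biUnion fun z _ => ?_)
    exact isClosed_le (by fun_prop) continuous_const

lemma isUniformCover_netPoints {F : ℕ → Set T} (hF : ∀ k, (F k).Finite) (hFX : ∀ k, F k ⊆ Xᶜ) :
    IsUniformCover Xᶜ ({B | ∃ x ∈ X, ∃ t : ℝ, B = netPoints F x t} ∪ {B | ∃ z ∈ Xᶜ, B = {z}}) := by
  have hsub : ∀ x t, netPoints F x t ⊆ Xᶜ := by
    rintro x t z ⟨k, -, hz, -⟩
    exact hFX k hz
  refine ⟨⟨?_, fun ε hε => ?_⟩, ?_⟩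
  · intro p hp
    obtain ⟨B, ⟨x, hx, t, rfl⟩ | ⟨z, hz, rfl⟩, hp1, hp2⟩ := mem_iUnion₂.1 hp
    · exact ⟨hsub _ _ hp1, hsub _ _ hp2⟩
    · rw [mem_singleton_iff] at hp1 hp2
      exact ⟨hp1 ▸ hz, hp2 ▸ hz⟩
  · obtain ⟨N, hN⟩ := exists_nat_one_div_lt (half_pos hε)
    refine ⟨⋃ k ∈ Iio (N + 2), F k, iUnion₂_subset fun k _ => hFX k,
      ((finite_Iio _).biUnion fun k _ => hF k).isCompact, ?_⟩
    rintro ⟨p, q⟩ ⟨hpq, hK⟩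
    obtain ⟨B, ⟨x, hx, t, rfl⟩ | ⟨z, hz, rfl⟩, hp, hq⟩ := mem_iUnion₂.1 hpq
    · obtain ⟨k, hk, hkF, hkx⟩ := hp
      obtain ⟨l, hl, hlF, hlx⟩ := hq
      rw [abs_le] at hk hl
      have hor : N + 2 ≤ k ∨ N + 2 ≤ l := by
        by_contra! hlt
        exact hK ⟨mem_iUnion₂.2 ⟨k, hlt.1, hkF⟩, mem_iUnion₂.2 ⟨l, hlt.2, hlF⟩⟩
      have h1 : (k : ℝ) ≤ l + 2 := by linarith
      have h2 : (l : ℝ) ≤ k + 2 := by linarith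
      norm_cast at h1 h2
      have h3 : 1 / ((k : ℝ) + 1) ≤ 1 / ((N : ℝ) + 1) := one_div_le_one_div_of_le (by positivity)
        (by exact_mod_cast (show N + 1 ≤ k + 1 by omega))
      have h4 : 1 / ((l : ℝ) + 1) ≤ 1 / ((N : ℝ) + 1) := one_div_le_one_div_of_le (by positivity)
        (by exact_mod_cast (show N + 1 ≤ l + 1 by omega))
      dsimp only at hkx hlx ⊢
      linarith [dist_triangle_right p q x]
    · rw [mem_singleton_iff] at hp hq
      dsimp only at hp hq ⊢
      rw [hp, hq, dist_self]
      exact hε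
  · refine Subset.antisymm ?_ fun z hz => ⟨{z}, Or.inr ⟨z, hz, rfl⟩, rfl⟩
    rintro z ⟨B, ⟨x, hx, t, rfl⟩ | ⟨w, hw, rfl⟩, hz⟩
    · exact hsub _ _ hz
    · rw [mem_singleton_iff] at hz
      exact hz ▸ hw

lemma infDist_le_of_mem_netPoints {F : ℕ → Set T} {x z : T} (hx : x ∈ X) {t : ℝ} {m : ℕ}
    (hm : (m : ℝ) + 1 ≤ t) (hz : z ∈ netPoints F x t) :
    dist z x ≤ 1 / ((m : ℝ) + 1) ∧ infDist z X ≤ 1 / ((m : ℝ) + 1) := by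
  obtain ⟨k, hk, -, hkx⟩ := hz
  have : dist z x ≤ 1 / ((m : ℝ) + 1) := by
    refine hkx.trans (one_div_le_one_div_of_le (by positivity) ?_)
    linarith [(abs_le.1 hk).2]
  exact ⟨this, (infDist_le_dist_of_mem hx).trans this⟩

theorem AsdimLE.exists_partition [CompactSpace T] (hX : IsClosed X) (hnd : IsNowhereDense X)
    (hne : X.Nonempty) {m : ℕ} (h : AsdimLE Xᶜ m) {δ : ℝ} (hδ : 0 < δ) :
    ∃ (N : ℕ) (f : Fin N → C(X × unitInterval, ℝ)), (∀ i z, 0 ≤ f i z) ∧ (∀ z, ∑ i, f i z = 1) ∧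
      (∀ z (S : Finset (Fin N)), (∀ i ∈ S, f i z ≠ 0) → S.card ≤ m + 1) ∧
      (∀ i x t x' t', f i (x, t) ≠ 0 → f i (x', t') ≠ 0 → dist x x' < δ) ∧
      ∀ i x x', f i (x, 0) ≠ 0 → f i (x', 1) = 0 := by
  classical
  have : CompactSpace X := isCompact_iff_compactSpace.1 hX.isCompact
  choose F hFf hFX hF using fun k : ℕ =>
    exists_finite_net hX hnd (show (0 : ℝ) < 1 / ((k : ℝ) + 1) by positivity)
  obtain ⟨α, hα, hβα, hmult⟩ := h _ (isUniformCover_netPoints hFf hFX)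
  obtain ⟨η, hη, hηα⟩ := MemC0.exists_infDist hX hne hα.1 (show 0 < δ / 3 by positivity)
  obtain ⟨a, ha⟩ := exists_nat_one_div_lt (lt_min hη (show 0 < δ / 3 by positivity))
  rw [lt_min_iff] at ha
  obtain ⟨ρ, hρ, hρF⟩ : ∃ ρ > 0, ∀ z ∈ ⋃ k ∈ Iio (a + 3), F k, ρ ≤ infDist z X := by
    have hfin := (finite_Iio (a + 3)).biUnion fun k _ => hFf k
    rcases (⋃ k ∈ Iio (a + 3), F k).eq_empty_or_nonempty with he | hne'
    · exact ⟨1, one_pos, by rw [he]; simp⟩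
    · obtain ⟨z, hz, hmin⟩ := exists_min_image _ (fun z => infDist z X) hfin hne'
      obtain ⟨k, -, hk⟩ := mem_iUnion₂.1 hz
      exact ⟨_, (hX.notMem_iff_infDist_pos hne).1 (hFX k hk), hmin⟩
  obtain ⟨y, hy, hyα⟩ := hα.1.exists_threshold hX hne hρ
  obtain ⟨b, hb⟩ := exists_nat_one_div_lt hy
  let τ : unitInterval → ℝ := fun s => (a + 1) + s * b
  have hτ : Continuous τ := by fun_prop
  have hτa : ∀ s, (a : ℝ) + 1 ≤ τ s := fun s => by
    have := mul_nonneg s.2.1 (Nat.cast_nonneg (α := ℝ) b)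
    simp only [τ]
    linarith
  let O : α → Set (X × unitInterval) := fun U => {q | netPoints F q.1 (τ q.2) ⊆ U}
  have hO : ∀ U, IsOpen (O U) := fun U =>
    (isOpen_netPoints_subset hFf U).preimage
      ((continuous_subtype_val.comp continuous_fst).prodMk (hτ.comp continuous_snd))
  obtain ⟨t, ht⟩ := isCompact_univ.elim_finite_subcover O hO (by
    rintro ⟨x, s⟩ -
    obtain ⟨U, hU, hsub⟩ := hβα _ (Or.inl ⟨x, x.2, τ s, rfl⟩)
    exact mem_iUnion.2 ⟨⟨U, hU⟩, hsub⟩)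
  let e := t.equivFin
  obtain ⟨p, hp⟩ := PartitionOfUnity.exists_isSubordinate_of_locallyFinite (s := univ)
    isClosed_univ (fun i => O (e.symm i)) (fun i => hO _) (locallyFinite_of_finite _) (by
      intro q hq
      obtain ⟨U, hU, hqU⟩ := mem_iUnion₂.1 (ht hq)
      exact mem_iUnion.2 ⟨e ⟨U, hU⟩, by simpa using hqU⟩)
  have hpO : ∀ i q, p i q ≠ 0 → netPoints F q.1 (τ q.2) ⊆ (e.symm i : α) := fun i q hq =>
    hp i (subset_tsupport _ hq)
  have hnon : ∀ (x : X) s, (netPoints F x (τ s)).Nonempty := fun x s =>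
    netPoints_nonempty hF x.2 ((by positivity : (0 : ℝ) ≤ a + 1).trans (hτa s))
  refine ⟨t.card, fun i => p i, fun i z => p.nonneg i z, fun z => ?_, fun z S hS => ?_,
    fun i x s x' s' h1 h2 => ?_, fun i x x' h1 => ?_⟩
  · rw [← finsum_eq_sum_of_fintype]
    exact p.sum_eq_one (mem_univ z)
  · have hinj : Function.Injective fun i => (((e.symm i : t) : α) : Set T) :=
      Subtype.val_injective.comp (Subtype.val_injective.comp e.symm.injective)
    rw [← Finset.card_image_of_injective S hinj]
    obtain ⟨w, hw⟩ := hnon z.1 z.2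
    refine hmult _ (fun U hU => ?_) ⟨w, fun U hU => ?_⟩
    · obtain ⟨i, -, rfl⟩ := Finset.mem_image.1 hU
      exact Subtype.property _
    · obtain ⟨i, hi, rfl⟩ := Finset.mem_image.1 hU
      exact hpO i z (hS i hi) hw
  · obtain ⟨z, hz⟩ := hnon x s
    obtain ⟨z', hz'⟩ := hnon x' s'
    have h3 := infDist_le_of_mem_netPoints x.2 (hτa s) hz
    have h4 := infDist_le_of_mem_netPoints x'.2 (hτa s') hz'
    have h5 := hηα (z, z') (mem_iUnion₂.2
      ⟨_, (e.symm i : α).2, hpO i _ h1 hz, hpO i _ h2 hz'⟩) (Or.inl (h3.2.trans_lt ha.1))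
    have h6 : dist (x : T) x' ≤ dist (x : T) z + dist z z' + dist z' x' := dist_triangle4 _ _ _ _
    rw [dist_comm (x : T) z] at h6
    rw [Subtype.dist_eq]
    dsimp only at h5
    linarith [h3.1, h4.1]
  · by_contra h2
    obtain ⟨z, hz⟩ := hnon x 0
    obtain ⟨z', hz'⟩ := hnon x' 1
    have hτb : (b : ℝ) + 1 ≤ τ 1 := by
      simp only [τ, Icc.coe_one, one_mul]
      linarith [Nat.cast_nonneg (α := ℝ) a]
    have h3 := infDist_le_of_mem_netPoints x'.2 hτb hz'
    refine (hyα _ hb.le _ (e.symm i : α).2 z' (hpO i _ h2 hz') z (hpO i _ h1 hz) h3.2).not_ge ?_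
    obtain ⟨k, hk, hkF, -⟩ := hz
    refine hρF z (mem_iUnion₂.2 ⟨k, ?_, hkF⟩)
    have h4 := (abs_le.1 hk).1
    simp only [τ, Icc.coe_zero, zero_mul, add_zero] at h4
    have h5 : (k : ℝ) ≤ a + 2 := by linarith
    have h6 : k ≤ a + 2 := by exact_mod_cast h5
    exact mem_Iio.2 (by omega)

end Partition

lemma HasNonvanishingExt.of_approx {Y V : Type*} [TopologicalSpace Y] [NormalSpace Y]
    [NormedAddCommGroup V] [NormedSpace ℝ V]
    (H : ∀ (F : C(Y, V)) (A : Set Y), IsClosed A → (∀ a ∈ A, F a ≠ 0) →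
      ∃ g : C(Y, V), (∀ y, g y ≠ 0) ∧ ∀ a ∈ A, ‖g a - F a‖ < ‖F a‖) :
    HasNonvanishingExt Y V := by
  intro F A hA hF
  obtain ⟨g, hg0, hgA⟩ := H F A hA hF
  have hO : IsClosed {y | ‖F y‖ ≤ ‖g y - F y‖} := isClosed_le (by fun_prop) (by fun_prop)
  obtain ⟨s, hs0, hs1, hs⟩ := exists_continuous_zero_one_of_isClosed hO hA
    (disjoint_left.2 fun y hy hyA => (hgA y hyA).not_ge hy)
  refine ⟨⟨fun y => g y + s y • (F y - g y), by fun_prop⟩, fun y => ?_, fun a ha => ?_⟩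
  · change g y + s y • (F y - g y) ≠ 0
    by_cases hy : ‖F y‖ ≤ ‖g y - F y‖
    · rw [hs0 hy]
      simpa using hg0 y
    · intro h0
      have h1 : F y = -((1 - s y) • (g y - F y)) := by
        rw [← sub_eq_zero, ← h0]
        module
      have h2 : ‖F y‖ ≤ ‖g y - F y‖ := by
        rw [h1, norm_neg, norm_smul, ← h1]
        refine mul_le_of_le_one_left (norm_nonneg _) ?_
        rw [Real.norm_eq_abs, abs_le]
        constructor <;> linarith [(hs y).1, (hs y).2]
      exact hy h2
  · simp [hs1 ha]

lemma HasNonvanishingExt.congr {Y V W : Type*} [TopologicalSpace Y]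
    [NormedAddCommGroup V] [NormedSpace ℝ V] [NormedAddCommGroup W] [NormedSpace ℝ W]
    (H : HasNonvanishingExt Y V) (e : V ≃L[ℝ] W) : HasNonvanishingExt Y W := by
  intro F A hA hF
  obtain ⟨g, hg0, hgA⟩ := H ⟨fun y => e.symm (F y), by fun_prop⟩ A hA
    (fun a ha => by simpa using hF a ha)
  exact ⟨⟨fun y => e (g y), by fun_prop⟩, fun y => by simpa using hg0 y, fun a ha => by
    simp [hgA a ha]⟩

/-- Affine combinations of few maps on a space of small dimension miss a dense set of values. -/
lemma dense_compl_affineCombinations {J E W : Type*} [Fintype J]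
    [NormedAddCommGroup E] [NormedSpace ℝ E] [FiniteDimensional ℝ E]
    [NormedAddCommGroup W] [NormedSpace ℝ W] [FiniteDimensional ℝ W]
    (f : J → E → W) (hf : ∀ j, ContDiff ℝ 1 (f j)) {m : ℕ}
    (hm : m + Module.finrank ℝ E < Module.finrank ℝ W) :
    Dense {w | ∃ (κ : J → ℝ) (S : Finset J) (e : E), S.card ≤ m + 1 ∧ (∀ j ∉ S, κ j = 0) ∧
      ∑ j, κ j = 1 ∧ w = ∑ j, κ j • f j e}ᶜ := by
  classical
  let Φ : (p : Finset J × J) → ((p.1.erase p.2 → ℝ) × E) → W := fun p q =>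
    f p.2 q.2 + ∑ j, q.1 j • (f j q.2 - f p.2 q.2)
  have hΦ : ∀ p, ContDiff ℝ 1 (Φ p) := by
    intro p
    refine ((hf _).comp contDiff_snd).add (ContDiff.sum fun j _ => ContDiff.smul ?_ ?_)
    · exact (contDiff_apply ℝ ℝ j).comp contDiff_fst
    · exact ((hf _).comp contDiff_snd).sub ((hf _).comp contDiff_snd)
  have hdim : ∀ p : {p : Finset J × J // p.1.card ≤ m + 1 ∧ p.2 ∈ p.1},
      dimH (range (Φ p)) ≤ (m + Module.finrank ℝ E : ℕ) := by
    rintro ⟨p, hp1, hp2⟩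
    refine (hΦ p).dimH_range_le.trans ?_
    rw [Module.finrank_prod, Module.finrank_fintype_fun_eq_card, Fintype.card_coe,
      Finset.card_erase_of_mem hp2]
    exact_mod_cast (by omega)
  refine Dense.mono (compl_subset_compl.2 ?_) (dense_compl_of_dimH_lt_finrank
    (s := ⋃ p : {p : Finset J × J // p.1.card ≤ m + 1 ∧ p.2 ∈ p.1}, range (Φ p)) ?_)
  · rintro w ⟨κ, S, e, hS, hκ, hκ1, rfl⟩
    obtain ⟨s, hs⟩ : S.Nonempty := by
      by_contra h
      rw [Finset.not_nonempty_iff_eq_empty] at h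
      subst h
      simp [hκ] at hκ1
    refine mem_iUnion.2 ⟨⟨(S, s), hS, hs⟩, (fun j => κ j, e), ?_⟩
    have h1 : ∑ j, κ j • f j e = f s e + ∑ j, κ j • (f j e - f s e) := by
      simp_rw [smul_sub, Finset.sum_sub_distrib, ← Finset.sum_smul, hκ1]
      simp
    rw [h1]
    change f s e + ∑ j : S.erase s, κ j • (f j e - f s e) = _
    congr 1
    rw [Finset.sum_coe_sort (S.erase s) (fun j => κ j • (f j e - f s e))]
    refine Finset.sum_subset (Finset.subset_univ _) fun j _ hj => ?_
    rw [Finset.mem_erase, not_and_or, not_not] at hj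
    rcases hj with rfl | hj
    · simp
    · simp [hκ j hj]
  · rw [dimH_iUnion]
    refine lt_of_le_of_lt (iSup_le hdim) ?_
    exact_mod_cast hm

/-- `Y × [0, 1]` has fine partitions of unity of multiplicity at most `m` no member of which is
nonzero at both ends. -/
def HasSeparatingPartitions (Y : Type*) [MetricSpace Y] (m : ℕ) : Prop :=
  ∀ δ > 0, ∃ (N : ℕ) (f : Fin N → C(Y × unitInterval, ℝ)),
    (∀ i z, 0 ≤ f i z) ∧ (∀ z, ∑ i, f i z = 1) ∧
    (∀ z (S : Finset (Fin N)), (∀ i ∈ S, f i z ≠ 0) → S.card ≤ m) ∧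
    (∀ i x t x' t', f i (x, t) ≠ 0 → f i (x', t') ≠ 0 → dist x x' < δ) ∧
    ∀ i x x', f i (x, 0) ≠ 0 → f i (x', 1) = 0

lemma norm_sum_smul_sub_le {ι V : Type*} [Fintype ι] [NormedAddCommGroup V] [NormedSpace ℝ V]
    {κ : ι → ℝ} (h0 : ∀ i, 0 ≤ κ i) (h1 : ∑ i, κ i = 1) {y : ι → V} {v : V} {r : ℝ}
    (h : ∀ i, κ i ≠ 0 → ‖y i - v‖ ≤ r) : ‖∑ i, κ i • y i - v‖ ≤ r := by
  have : ∑ i, κ i • y i - v = ∑ i, κ i • (y i - v) := by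
    simp_rw [smul_sub, Finset.sum_sub_distrib, ← Finset.sum_smul, h1, one_smul]
  rw [this]
  calc ‖∑ i, κ i • (y i - v)‖ ≤ ∑ i, κ i * r := by
        refine norm_sum_le_of_le _ fun i _ => ?_
        rw [norm_smul, Real.norm_of_nonneg (h0 i)]
        by_cases hi : κ i = 0
        · simp [hi]
        · exact mul_le_mul_of_nonneg_left (h i hi) (h0 i)
    _ = r := by rw [← Finset.sum_mul, h1, one_mul]

lemma exists_separating_function {Y : Type*} [MetricSpace Y] [CompactSpace Y] {n N : ℕ}
    (f : Fin N → C(Y × unitInterval, ℝ))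
    (hends : ∀ i x x', f i (x, 0) ≠ 0 → f i (x', 1) = 0)
    {M : Set (Y × unitInterval)} (hM : IsClosed M)
    (hcard : ∀ z ∈ M, (Finset.univ.filter fun i => f i z ≠ 0).card = n + 1) :
    ∃ ζ : C(Y × unitInterval, ℝ), (∀ z, ζ z ∈ Icc (0 : ℝ) 1) ∧ (∀ z ∈ M, ζ z = 0 ∨ ζ z = 1) ∧
      (∀ x, ζ (x, 0) = 0) ∧ ∀ x, ζ (x, 1) = 1 := by
  classical
  let MS : Finset (Fin N) → Set (Y × unitInterval) := fun S => {z ∈ M | ∀ i ∉ S, f i z = 0}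
  have hMS : ∀ S, IsClosed (MS S) := fun S => by
    have : MS S = M ∩ ⋂ i, ⋂ _ : i ∉ S, {z | f i z = 0} := by ext z; simp [MS]
    rw [this]
    exact hM.inter (isClosed_iInter fun i => isClosed_iInter fun _ =>
      isClosed_eq (f i).continuous continuous_const)
  have hsupp : ∀ S, S.card = n + 1 → ∀ z ∈ MS S, Finset.univ.filter (fun i => f i z ≠ 0) = S := by
    intro S hS z hz
    refine Finset.eq_of_subset_of_card_le (fun i hi => ?_) (by rw [hS, hcard z hz.1])
    by_contra hiS
    exact (Finset.mem_filter.1 hi).2 (hz.2 i hiS)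
  let up : Set (Finset (Fin N)) := {S | S.card = n + 1 ∧ ∃ i ∈ S, ∃ x, f i (x, 0) ≠ 0}
  let low : Set (Finset (Fin N)) := {S | S.card = n + 1 ∧ ∀ i ∈ S, ∀ x, f i (x, 0) = 0}
  have hup : IsClosed ((⋃ S ∈ up, MS S) ∪ {z | z.2 = 0}) :=
    (up.toFinite.isClosed_biUnion fun S _ => hMS S).union (isClosed_eq continuous_snd continuous_const)
  have hlow : IsClosed ((⋃ S ∈ low, MS S) ∪ {z | z.2 = 1}) :=
    (low.toFinite.isClosed_biUnion fun S _ => hMS S).union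
      (isClosed_eq continuous_snd continuous_const)
  obtain ⟨ζ, h0, h1, h01⟩ := exists_continuous_zero_one_of_isClosed hup hlow (by
    rw [disjoint_left]
    rintro ⟨x, t⟩ (hz | hz) (hz' | hz')
    · obtain ⟨S, hS, hzS⟩ := mem_iUnion₂.1 hz
      obtain ⟨S', hS', hzS'⟩ := mem_iUnion₂.1 hz'
      have : S = S' := by rw [← hsupp S hS.1 _ hzS, ← hsupp S' hS'.1 _ hzS']
      subst this
      obtain ⟨i, hi, y, hy⟩ := hS.2
      exact hy (hS'.2 i hi y)
    · obtain ⟨S, hS, hzS⟩ := mem_iUnion₂.1 hz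
      obtain rfl : t = 1 := hz'
      obtain ⟨i, hi, y, hy⟩ := hS.2
      rw [← hsupp S hS.1 _ hzS] at hi
      exact (Finset.mem_filter.1 hi).2 (hends i y x hy)
    · obtain ⟨S, hS, hzS⟩ := mem_iUnion₂.1 hz'
      obtain rfl : t = 0 := hz
      obtain ⟨i, hi⟩ := Finset.card_pos.1 (show 0 < S.card by rw [hS.1]; omega)
      have hi' := hi
      rw [← hsupp S hS.1 _ hzS] at hi'
      exact (Finset.mem_filter.1 hi').2 (hS.2 i hi x)
    · exact zero_ne_one (α := unitInterval) ((show t = 0 from hz).symm.trans hz'))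
  refine ⟨ζ, h01, fun z hz => ?_, fun x => h0 (Or.inr rfl), fun x => h1 (Or.inr rfl)⟩
  have hzS : z ∈ MS (Finset.univ.filter fun i => f i z ≠ 0) :=
    ⟨hz, fun i hi => by simpa using hi⟩
  by_cases h : ∃ i ∈ Finset.univ.filter (fun i => f i z ≠ 0), ∃ x, f i (x, 0) ≠ 0
  · exact Or.inl (h0 (Or.inl (mem_iUnion₂.2 ⟨_, ⟨hcard z hz, h⟩, hzS⟩)))
  · push Not at h
    exact Or.inr (h1 (Or.inl (mem_iUnion₂.2 ⟨_, ⟨hcard z hz, h⟩, hzS⟩)))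

/-- A map can be approximated on `Y × [0, 1]` by one whose zeros are separated into an upper and
a lower part. -/
lemma HasSeparatingPartitions.exists_approx {Y V : Type*} [MetricSpace Y] [CompactSpace Y]
    [NormedAddCommGroup V] [NormedSpace ℝ V] [FiniteDimensional ℝ V] {n : ℕ}
    (H : HasSeparatingPartitions Y (n + 2)) (hV : Module.finrank ℝ V = n + 1)
    (F : C(Y, V)) {c : ℝ} (hc : 0 < c) :
    ∃ (Φ : C(Y × unitInterval, V)) (ζ : C(Y × unitInterval, ℝ)),
      (∀ z, ‖Φ z - F z.1‖ < c) ∧ (∀ z, ζ z ∈ Icc (0 : ℝ) 1) ∧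
      (∀ z, Φ z = 0 → ζ z = 0 ∨ ζ z = 1) ∧ (∀ x, ζ (x, 0) = 0) ∧ ∀ x, ζ (x, 1) = 1 := by
  classical
  obtain ⟨δ, hδ, hF⟩ := Metric.uniformContinuous_iff.1
    (CompactSpace.uniformContinuous_of_continuous F.continuous) (c / 2) (half_pos hc)
  obtain ⟨N, f, hf0, hf1, hfm, hfδ, hfe⟩ := H δ hδ
  have hy : ∀ i, ∃ y : V, ∀ z, f i z ≠ 0 → ‖y - F z.1‖ ≤ c / 2 := by
    intro i
    by_cases h : ∃ z, f i z ≠ 0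
    · obtain ⟨z, hz⟩ := h
      refine ⟨F z.1, fun z' hz' => ?_⟩
      rw [← dist_eq_norm]
      exact (hF (hfδ i z.1 z.2 z'.1 z'.2 hz hz')).le
    · push Not at h
      exact ⟨0, fun z hz => absurd (h z) hz⟩
  choose y hy using hy
  obtain ⟨b, hb, hbn⟩ := (dense_compl_affineCombinations (E := Fin 0 → ℝ) (m := n)
    (fun i (_ : Fin 0 → ℝ) => y i) (fun i => contDiff_const) (by simp [hV])).exists_dist_lt 0
    (half_pos hc)
  rw [dist_zero_left] at hbn
  let Φ : C(Y × unitInterval, V) := ⟨fun z => ∑ i, f i z • y i - b, by fun_prop⟩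
  have hM : IsClosed {z | Φ z = 0} := isClosed_eq Φ.continuous continuous_const
  obtain ⟨ζ, h1, h2, h3, h4⟩ := exists_separating_function (n := n + 1) f hfe hM (by
    intro z hz
    refine le_antisymm (hfm z _ fun i hi => (Finset.mem_filter.1 hi).2) ?_
    by_contra hlt
    refine hb ⟨fun i => f i z, Finset.univ.filter (fun i => f i z ≠ 0), 0, by omega,
      fun j hj => by simpa using hj, hf1 z, ?_⟩
    exact (sub_eq_zero.1 (show ∑ i, f i z • y i - b = 0 from hz)).symm)
  refine ⟨Φ, ζ, fun z => ?_, h1, h2, h3, h4⟩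
  have h5 := norm_sum_smul_sub_le (hf0 · z) (hf1 z) (fun i hi => hy i z hi)
  calc ‖Φ z - F z.1‖ = ‖(∑ i, f i z • y i - F z.1) - b‖ := by
        congr 1
        change ∑ i, f i z • y i - b - F z.1 = _
        abel
    _ ≤ ‖∑ i, f i z • y i - F z.1‖ + ‖b‖ := norm_sub_le _ _
    _ < c := by linarith

/-- Transport of a section of a subbundle along the interval. -/
lemma exists_transport {Y 𝕜 V : Type*} [MetricSpace Y] [CompactSpace Y] [RCLike 𝕜]
    [NormedAddCommGroup V] [NormedSpace 𝕜 V] (p : C(Y × unitInterval, V →L[𝕜] V))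
    (hp : ∀ z v, p z (p z v) = p z v) {v₀ : V} (hv₀ : v₀ ≠ 0) (h1 : ∀ x, p (x, 1) v₀ = v₀) :
    ∃ v : C(Y, V), (∀ x, v x ≠ 0) ∧ (∀ x, p (x, 0) (v x) = v x) ∧
      ∀ x, (∀ t, p (x, t) v₀ = v₀) → v x = v₀ := by
  obtain ⟨δ, hδ, hpδ⟩ := Metric.uniformContinuous_iff.1
    (CompactSpace.uniformContinuous_of_continuous p.continuous) 1 one_pos
  obtain ⟨M, hM⟩ := exists_nat_one_div_lt hδ
  let τ : ℕ → unitInterval := fun k => projIcc 0 1 zero_le_one (1 - (k : ℝ) / ((M : ℝ) + 1))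
  have hτ : ∀ k, dist (τ (k + 1)) (τ k) < δ := by
    intro k
    refine lt_of_le_of_lt ?_ hM
    rw [Subtype.dist_eq, Real.dist_eq]
    refine (abs_projIcc_sub_projIcc zero_le_one).trans ?_
    rw [show 1 - ((k + 1 : ℕ) : ℝ) / ((M : ℝ) + 1) - (1 - (k : ℝ) / (M + 1)) = -(1 / ((M : ℝ) + 1)) by
      push_cast; ring, abs_neg, abs_of_pos (by positivity)]
  have key : ∀ k, ∃ v : C(Y, V), (∀ x, v x ≠ 0) ∧ (∀ x, p (x, τ k) (v x) = v x) ∧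
      ∀ x, (∀ t, p (x, t) v₀ = v₀) → v x = v₀ := by
    intro k
    induction k with
    | zero =>
      refine ⟨ContinuousMap.const Y v₀, fun _ => hv₀, fun x => ?_, fun _ _ => rfl⟩
      have : τ 0 = 1 := by
        simp only [τ, Nat.cast_zero, zero_div, sub_zero, projIcc_right]
        rfl
      rw [this]
      exact h1 x
    | succ k ih =>
      obtain ⟨v, hv0, hvp, hv⟩ := ih
      refine ⟨⟨fun x => p (x, τ (k + 1)) (v x), by fun_prop⟩, fun x h0 => ?_, fun x => hp _ _,
        fun x hx => ?_⟩
      · have h0 : p (x, τ (k + 1)) (v x) = 0 := h0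
        have h2 : ‖p (x, τ (k + 1)) - p (x, τ k)‖ < 1 := by
          rw [← dist_eq_norm]
          exact hpδ (by simpa [Prod.dist_eq] using hτ k)
        have h3 := (p (x, τ (k + 1)) - p (x, τ k)).le_opNorm (v x)
        rw [sub_apply, h0, hvp, zero_sub, norm_neg] at h3
        have := norm_pos_iff.2 (hv0 x)
        nlinarith
      · change p _ (v x) = _
        rw [hv x hx, hx]
  obtain ⟨v, hv0, hvp, hv⟩ := key (M + 1)
  refine ⟨v, hv0, fun x => ?_, hv⟩
  have : τ (M + 1) = 0 := by
    have : (M : ℝ) + 1 ≠ 0 := by positivity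
    simp only [τ, Nat.cast_add, Nat.cast_one, div_self this, sub_self, projIcc_left]
    rfl
  rw [← this]
  exact hvp x

/-- The orthogonal projection of `𝕜 × 𝕜` with the given matrix entries `1 - s`, `w`, `conj w`
and `s`. -/
noncomputable def planeProj {𝕜 : Type*} [RCLike 𝕜] (s : ℝ) (w : 𝕜) : 𝕜 × 𝕜 →L[𝕜] 𝕜 × 𝕜 :=
  ((1 - s : ℝ) : 𝕜) • (ContinuousLinearMap.inl 𝕜 𝕜 𝕜 ∘L ContinuousLinearMap.fst 𝕜 𝕜 𝕜) +
  w • (ContinuousLinearMap.inl 𝕜 𝕜 𝕜 ∘L ContinuousLinearMap.snd 𝕜 𝕜 𝕜) +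
  (starRingEnd 𝕜 w) • (ContinuousLinearMap.inr 𝕜 𝕜 𝕜 ∘L ContinuousLinearMap.fst 𝕜 𝕜 𝕜) +
  (s : 𝕜) • (ContinuousLinearMap.inr 𝕜 𝕜 𝕜 ∘L ContinuousLinearMap.snd 𝕜 𝕜 𝕜)

lemma planeProj_apply {𝕜 : Type*} [RCLike 𝕜] (s : ℝ) (w : 𝕜) (v : 𝕜 × 𝕜) :
    planeProj s w v = ((1 - s) * v.1 + w * v.2, (starRingEnd 𝕜 w) * v.1 + s * v.2) := by
  ext <;> simp [planeProj, RCLike.real_smul_eq_coe_mul]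

lemma planeProj_idem {𝕜 : Type*} [RCLike 𝕜] {s : ℝ} {w : 𝕜} (h : ‖w‖ ^ 2 = s * (1 - s))
    (v : 𝕜 × 𝕜) : planeProj s w (planeProj s w v) = planeProj s w v := by
  have h' : w * (starRingEnd 𝕜 w) = s * (1 - s) := by
    rw [RCLike.mul_conj]
    exact_mod_cast h
  ext <;> simp only [planeProj_apply]
  · linear_combination v.1 * h'
  · linear_combination v.2 * h'

lemma continuous_planeProj {𝕜 Z : Type*} [RCLike 𝕜] [TopologicalSpace Z] {s : Z → ℝ} {w : Z → 𝕜}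
    (hs : Continuous s) (hw : Continuous w) : Continuous fun z => planeProj (s z) (w z) := by
  unfold planeProj
  have h1 : Continuous fun z => ((1 - s z : ℝ) : 𝕜) :=
    RCLike.continuous_ofReal.comp (continuous_const.sub hs)
  have h2 : Continuous fun z => ((s z : ℝ) : 𝕜) := RCLike.continuous_ofReal.comp hs
  have h3 : Continuous fun z => starRingEnd 𝕜 (w z) := RCLike.continuous_conj.comp hw
  fun_prop

/-- If the zeros of `Φ` are separated, then its restriction to the bottom can be deformed to a
nowhere vanishing map. -/
lemma exists_nonvanishing_of_separated {Y 𝕜 : Type*} [MetricSpace Y] [CompactSpace Y] [RCLike 𝕜]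
    (Φ : C(Y × unitInterval, 𝕜)) (ζ : C(Y × unitInterval, ℝ))
    (hζ : ∀ z, Φ z = 0 → ζ z = 0 ∨ ζ z = 1) (hζn : ∀ z, 0 ≤ ζ z)
    (hζ0 : ∀ x, ζ (x, 0) = 0) (hζ1 : ∀ x, ζ (x, 1) = 1) {c : ℝ} (hc : 0 < c) :
    ∃ g : C(Y, 𝕜), (∀ x, g x ≠ 0) ∧ ∀ x, (∀ t, c ≤ ‖Φ (x, t)‖) → g x = Φ (x, 0) := by
  let χ : Y × unitInterval → ℝ := fun z => max 0 (1 - 2 * ζ z - ‖Φ z‖ / c)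
  have hχ : Continuous χ := by fun_prop
  have hχn : ∀ z, 0 ≤ χ z := fun z => le_max_left _ _
  have hχ0 : ∀ z, 1 ≤ 2 * ζ z → χ z = 0 := fun z hz => max_eq_left (by
    have := div_nonneg (norm_nonneg (Φ z)) hc.le
    linarith)
  have hχc : ∀ z, c ≤ ‖Φ z‖ → χ z = 0 := fun z hz => max_eq_left (by
    have := (one_le_div hc).2 hz
    linarith [hζn z])
  have hχ1 : ∀ z, Φ z = 0 → ζ z = 0 → χ z = 1 := fun z h1 h2 => by simp [χ, h1, h2]
  let D : Y × unitInterval → ℝ := fun z => ‖Φ z‖ ^ 2 + χ z ^ 2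
  have hD : Continuous D := by fun_prop
  have hD0 : ∀ z, D z = 0 → Φ z = 0 ∧ ζ z = 1 := by
    intro z hz
    have h1 : ‖Φ z‖ ^ 2 = 0 := le_antisymm (by nlinarith [sq_nonneg (χ z)]) (sq_nonneg _)
    have h2 : χ z ^ 2 = 0 := by simpa [D, h1] using hz
    have h3 : Φ z = 0 := by simpa using h1
    refine ⟨h3, (hζ z h3).resolve_left fun h4 => ?_⟩
    rw [hχ1 z h3 h4] at h2
    norm_num at h2
  let θ : Y × unitInterval → ℝ := fun z => χ z / D z
  have hθ : Continuous θ := by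
    rw [continuous_iff_continuousAt]
    intro z
    by_cases hz : D z = 0
    · have h1 : ∀ᶠ y in 𝓝 z, 1 < 2 * ζ y := by
        refine (isOpen_lt continuous_const (by fun_prop)).mem_nhds ?_
        simp [(hD0 z hz).2]
      refine (continuousAt_const (y := (0 : ℝ))).congr ?_
      filter_upwards [h1] with y hy
      simp [θ, hχ0 y hy.le]
    · exact hχ.continuousAt.div hD.continuousAt hz
  have hθD : ∀ z, θ z * D z = χ z := by
    intro z
    by_cases hz : D z = 0
    · rw [hz, mul_zero, hχ0 z (by rw [(hD0 z hz).2]; norm_num)]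
    · exact div_mul_cancel₀ _ hz
  let p : C(Y × unitInterval, 𝕜 × 𝕜 →L[𝕜] 𝕜 × 𝕜) :=
    ⟨fun z => planeProj (χ z * θ z) (Φ z * (θ z : 𝕜)), continuous_planeProj (hχ.mul hθ)
      (Φ.continuous.mul (RCLike.continuous_ofReal.comp hθ))⟩
  have hpe : ∀ z, χ z = 0 → p z (1, 0) = (1, 0) := by
    intro z hz
    have h0 : θ z = 0 := by simp [θ, hz]
    simp [p, planeProj_apply, hz, h0]
  obtain ⟨v, hv0, hvp, hv⟩ := exists_transport p (fun z v => planeProj_idem (by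
      rw [norm_mul, RCLike.norm_ofReal, mul_pow, sq_abs]
      have h1 := hθD z
      simp only [D] at h1
      linear_combination (θ z) * h1) v)
    (v₀ := (1, 0)) (by simp) (fun x => hpe _ (hχ0 _ (by rw [hζ1]; norm_num)))
  have hD0' : ∀ x, D (x, 0) ≠ 0 := fun x h => by
    have := (hD0 _ h).2
    rw [hζ0] at this
    exact zero_ne_one this
  let L : Y → 𝕜 := fun x => starRingEnd 𝕜 (Φ (x, 0)) * (v x).1 + (χ (x, 0) : 𝕜) * (v x).2
  have hL : Continuous L := by
    have h1 : Continuous fun x => starRingEnd 𝕜 (Φ (x, 0)) :=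
      RCLike.continuous_conj.comp (by fun_prop)
    have h2 : Continuous fun x => (χ (x, 0) : 𝕜) := RCLike.continuous_ofReal.comp (by fun_prop)
    fun_prop
  have hvL : ∀ x, (D (x, 0) : 𝕜) * (v x).1 = Φ (x, 0) * L x ∧
      (D (x, 0) : 𝕜) * (v x).2 = χ (x, 0) * L x := by
    intro x
    have h1 := hvp x
    simp only [p, ContinuousMap.coe_mk, planeProj_apply, map_mul, RCLike.conj_ofReal] at h1
    have h2 : (θ (x, 0) : 𝕜) * D (x, 0) = χ (x, 0) := by exact_mod_cast hθD (x, 0)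
    have h3 : (D (x, 0) : 𝕜) = Φ (x, 0) * starRingEnd 𝕜 (Φ (x, 0)) + χ (x, 0) * χ (x, 0) := by
      rw [RCLike.mul_conj]
      simp only [D]
      push_cast
      ring
    have h4 := congrArg Prod.fst h1
    have h5 := congrArg Prod.snd h1
    dsimp only at h4 h5
    constructor
    · simp only [L]
      linear_combination (-(D (x, 0) : 𝕜)) * h4 +
        (Φ (x, 0) * (v x).2 - χ (x, 0) * (v x).1) * h2 + (v x).1 * h3
    · simp only [L]
      linear_combination (-(D (x, 0) : 𝕜)) * h5 +
        (starRingEnd 𝕜 (Φ (x, 0)) * (v x).1 + χ (x, 0) * (v x).2) * h2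
  have hD' : ∀ x, (D (x, 0) : 𝕜) ≠ 0 := fun x => RCLike.ofReal_ne_zero.2 (hD0' x)
  have hL0 : ∀ x, L x ≠ 0 := by
    intro x h
    obtain ⟨h1, h2⟩ := hvL x
    rw [h, mul_zero] at h1 h2
    exact hv0 x (Prod.ext ((mul_eq_zero.1 h1).resolve_left (hD' x))
      ((mul_eq_zero.1 h2).resolve_left (hD' x)))
  refine ⟨⟨fun x => (D (x, 0) : 𝕜) / L x, ?_⟩, fun x => div_ne_zero (hD' x) (hL0 x), fun x hx => ?_⟩
  · exact (RCLike.continuous_ofReal.comp (by fun_prop)).div hL hL0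
  · have h1 : v x = (1, 0) := hv x fun t => hpe _ (hχc _ (hx t))
    have h2 := (hvL x).1
    rw [h1, mul_one] at h2
    exact (div_eq_iff (hL0 x)).2 h2

lemma exists_contDiff_approx {n : ℕ} (q : C(unitInterval, Fin n → ℝ)) {ε : ℝ} (hε : 0 < ε) :
    ∃ P : ℝ → Fin n → ℝ, ContDiff ℝ 1 P ∧ ∀ t : unitInterval, ‖P t - q t‖ < ε := by
  have h : ∀ i, ∃ p : Polynomial ℝ, ∀ x ∈ Icc (0 : ℝ) 1,
      |p.eval x - q (projIcc 0 1 zero_le_one x) i| < ε := fun i =>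
    exists_polynomial_near_of_continuousOn 0 1 _ (Continuous.continuousOn (by
      have : Continuous fun x : ℝ => projIcc (0 : ℝ) 1 zero_le_one x := continuous_projIcc
      exact (continuous_apply i).comp (q.continuous.comp this))) ε hε
  choose p hp using h
  refine ⟨fun x i => (p i).eval x, contDiff_pi.2 fun i => by
    simpa using (p i).contDiff_aeval (𝕜 := ℝ) 1, fun t => ?_⟩
  rw [pi_norm_lt_iff hε]
  intro i
  have := hp i t t.2
  rwa [projIcc_val] at this

/-- A map can be approximated on `Y × [0, 1]` by one which does not take a given generic pair of
small values over the same point. -/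
lemma HasSeparatingPartitions.exists_generic_approx {Y : Type*} [MetricSpace Y] [CompactSpace Y]
    {n : ℕ} (hn : 2 ≤ n) (H : HasSeparatingPartitions Y (n + 2))
    (Φ : C(Y × unitInterval, Fin (n + 1) → ℝ)) {ε : ℝ} (hε : 0 < ε) :
    ∃ (Ψ : C(Y × unitInterval, Fin (n + 1) → ℝ)) (b b' : Fin (n + 1) → ℝ), ‖b‖ < ε ∧ ‖b'‖ < ε ∧
      (∀ z, ‖Ψ z - Φ z‖ < ε) ∧ ∀ x t t', Ψ (x, t) = b → Ψ (x, t') ≠ b' := by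
  classical
  obtain ⟨δ, hδ, hΦ⟩ := Metric.uniformContinuous_iff.1
    (CompactSpace.uniformContinuous_of_continuous Φ.continuous) (ε / 3) (by positivity)
  obtain ⟨N, f, hf0, hf1, hfm, hfδ, -⟩ := H δ hδ
  have hP : ∀ i, ∃ P : ℝ → Fin (n + 1) → ℝ, ContDiff ℝ 1 P ∧
      ∀ x (t : unitInterval), f i (x, 0) ≠ 0 → ‖P t - Φ (x, t)‖ ≤ 2 * ε / 3 := by
    intro i
    by_cases h : ∃ x, f i (x, 0) ≠ 0
    · obtain ⟨y, hy⟩ := h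
      obtain ⟨P, hP, hPy⟩ := exists_contDiff_approx
        (⟨fun t => Φ (y, t), by fun_prop⟩ : C(unitInterval, Fin (n + 1) → ℝ))
        (show 0 < ε / 3 by positivity)
      refine ⟨P, hP, fun x t hx => ?_⟩
      have h1 := hPy t
      have h2 : dist (Φ (y, t)) (Φ (x, t)) < ε / 3 := hΦ (by
        simpa [Prod.dist_eq, hδ] using hfδ i y 0 x 0 hy hx)
      rw [dist_eq_norm] at h2
      have h3 := norm_add_le (P t - Φ (y, t)) (Φ (y, t) - Φ (x, t))
      rw [sub_add_sub_cancel] at h3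
      simp only [ContinuousMap.coe_mk] at h1
      linarith
    · push Not at h
      exact ⟨0, contDiff_const, fun x _ hx => absurd (h x) hx⟩
  choose P hP hPΦ using hP
  have hPc : ∀ i, Continuous (P i) := fun i => (hP i).continuous
  obtain ⟨⟨b, b'⟩, hb, hbn⟩ := (dense_compl_affineCombinations (E := ℝ × ℝ) (m := n + 1)
    (W := (Fin (n + 1) → ℝ) × (Fin (n + 1) → ℝ)) (fun i (t : ℝ × ℝ) => (P i t.1, P i t.2))
    (fun i => ((hP i).comp contDiff_fst).prodMk ((hP i).comp contDiff_snd))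
    (by simp; omega)).exists_dist_lt 0 hε
  rw [dist_zero_left, Prod.norm_def, max_lt_iff] at hbn
  refine ⟨⟨fun z => ∑ i, f i (z.1, 0) • P i z.2, by fun_prop⟩, b, b', hbn.1, hbn.2, fun z => ?_,
    fun x t t' h h' => hb ?_⟩
  · refine (norm_sum_smul_sub_le (fun i => hf0 i (z.1, 0)) (hf1 (z.1, 0))
      (fun i hi => hPΦ i z.1 z.2 hi)).trans_lt (by linarith)
  · refine ⟨fun i => f i (x, 0), Finset.univ.filter (fun i => f i (x, 0) ≠ 0), (t, t'),
      hfm (x, 0) _ fun i hi => (Finset.mem_filter.1 hi).2, fun j hj => by simpa using hj,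
      hf1 (x, 0), ?_⟩
    have h : ∑ i, f i (x, 0) • P i t = b := h
    have h' : ∑ i, f i (x, 0) • P i t' = b' := h'
    rw [← h, ← h']
    simp [Prod.ext_iff, Prod.fst_sum, Prod.snd_sum]

/-- If the zeros of `Φ` are separated, then some section of `Y × [0, 1]` avoids the zeros of a
nearby map. -/
lemma HasSeparatingPartitions.exists_nonvanishing {Y : Type*} [MetricSpace Y] [CompactSpace Y]
    {n : ℕ} (hn : 2 ≤ n) (H : HasSeparatingPartitions Y (n + 2))
    (Φ : C(Y × unitInterval, Fin (n + 1) → ℝ)) (ζ : C(Y × unitInterval, ℝ))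
    (hζ : ∀ z, Φ z = 0 → ζ z = 0 ∨ ζ z = 1)
    (hζ0 : ∀ x, ζ (x, 0) = 0) (hζ1 : ∀ x, ζ (x, 1) = 1) {c : ℝ} (hc : 0 < c) :
    ∃ g : C(Y, Fin (n + 1) → ℝ), (∀ x, g x ≠ 0) ∧ ∀ x, ∃ t, ‖g x - Φ (x, t)‖ < c := by
  obtain ⟨ε, hε, hεΦ⟩ : ∃ ε > 0, ∀ z, ‖Φ z‖ < ε → ζ z < 1 / 3 ∨ 2 / 3 < ζ z := by
    have hcl : IsClosed {z | 1 / 3 ≤ ζ z ∧ ζ z ≤ 2 / 3} :=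
      (isClosed_le continuous_const ζ.continuous).inter (isClosed_le ζ.continuous continuous_const)
    rcases {z | 1 / 3 ≤ ζ z ∧ ζ z ≤ 2 / 3}.eq_empty_or_nonempty with he | hne
    · refine ⟨1, one_pos, fun z _ => ?_⟩
      by_contra! h
      exact (he ▸ (show z ∈ {z | 1 / 3 ≤ ζ z ∧ ζ z ≤ 2 / 3} from h) : z ∈ (∅ : Set _))
    · obtain ⟨w, hw, hmin⟩ := hcl.isCompact.exists_isMinOn hne
        (f := fun z => ‖Φ z‖) (by fun_prop)
      refine ⟨‖Φ w‖, norm_pos_iff.2 fun h0 => ?_, fun z hz => ?_⟩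
      · rcases hζ w h0 with h | h <;> norm_num [h] at hw
      · by_contra! h
        exact (hmin (show z ∈ {z | 1 / 3 ≤ ζ z ∧ ζ z ≤ 2 / 3} from h)).not_gt hz
  obtain ⟨Ψ, b, b', hb, hb', hΨ, hgen⟩ :=
    H.exists_generic_approx hn Φ (show 0 < min ε c / 2 by positivity)
  let ξ : Y × unitInterval → ℝ := fun z => max 0 (min 1 (3 * ζ z - 1))
  have hξ : Continuous ξ := by fun_prop
  let Θ : C(Y × unitInterval, Fin (n + 1) → ℝ) :=
    ⟨fun z => Ψ z - ((1 - ξ z) • b + ξ z • b'), by fun_prop⟩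
  have hΘ : ∀ z, ‖Θ z - Φ z‖ < min ε c := by
    intro z
    have h1 : (1 - ξ z) • b + ξ z • b' ∈ ball (0 : Fin (n + 1) → ℝ) (min ε c / 2) :=
      (convex_ball _ _) (by simpa using hb) (by simpa using hb')
        (by simp [ξ]) (le_max_left _ _) (by ring)
    rw [mem_ball_zero_iff] at h1
    have h2 := norm_sub_le (Ψ z - Φ z) ((1 - ξ z) • b + ξ z • b')
    have h3 : Θ z - Φ z = Ψ z - Φ z - ((1 - ξ z) • b + ξ z • b') := by
      change Ψ z - ((1 - ξ z) • b + ξ z • b') - Φ z = _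
      abel
    rw [h3]
    linarith [hΨ z]
  have hzero : ∀ z, Θ z = 0 → (ζ z < 1 / 3 ∧ Ψ z = b) ∨ (2 / 3 < ζ z ∧ Ψ z = b') := by
    intro z hz
    have h1 := hΘ z
    rw [hz, zero_sub, norm_neg] at h1
    have h2 : Ψ z = (1 - ξ z) • b + ξ z • b' := sub_eq_zero.1 hz
    rcases hεΦ z (h1.trans_le (min_le_left _ _)) with h | h
    · have : ξ z = 0 := max_eq_left ((min_le_right _ _).trans (by linarith))
      exact Or.inl ⟨h, by simpa [this] using h2⟩
    · have : ξ z = 1 := by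
        have : min 1 (3 * ζ z - 1) = 1 := min_eq_left (by linarith)
        simp [ξ, this]
      exact Or.inr ⟨h, by simpa [this] using h2⟩
  have hΘc : IsClosed {z | Θ z = 0} := isClosed_eq Θ.continuous continuous_const
  have hlow : IsClosed (Prod.fst '' {z | Θ z = 0 ∧ 2 / 3 ≤ ζ z}) :=
    isClosedMap_fst_of_compactSpace _ (hΘc.inter (isClosed_le continuous_const ζ.continuous))
  have hup : IsClosed (Prod.fst '' {z | Θ z = 0 ∧ ζ z ≤ 1 / 3}) :=
    isClosedMap_fst_of_compactSpace _ (hΘc.inter (isClosed_le ζ.continuous continuous_const))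
  obtain ⟨τ, hτ0, hτ1, -⟩ := exists_continuous_zero_one_of_isClosed hlow hup (by
    rw [disjoint_left]
    rintro _ ⟨⟨x, t⟩, ⟨h1, h2⟩, rfl⟩ ⟨⟨x', t'⟩, ⟨h3, h4⟩, rfl⟩
    rcases hzero _ h1 with h | h
    · linarith [h.1]
    · rcases hzero _ h3 with h' | h'
      · exact hgen _ _ _ h'.2 h.2
      · linarith [h'.1])
  have hτ : Continuous fun x => projIcc (0 : ℝ) 1 zero_le_one (τ x) :=
    continuous_projIcc.comp τ.continuous
  refine ⟨⟨fun x => Θ (x, projIcc 0 1 zero_le_one (τ x)),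
    Θ.continuous.comp (continuous_id.prodMk hτ)⟩, fun x h0 => ?_, fun x =>
    ⟨_, (hΘ _).trans_le (min_le_right _ _)⟩⟩
  rcases hzero _ h0 with h | h
  · have h1 : τ x = 1 := hτ1 ⟨_, ⟨h0, h.1.le⟩, rfl⟩
    have h2 : projIcc (0 : ℝ) 1 zero_le_one (τ x) = 1 := by rw [h1]; exact projIcc_right _
    rw [h2, hζ1] at h
    linarith [h.1]
  · have h1 : τ x = 0 := hτ0 ⟨_, ⟨h0, h.1.le⟩, rfl⟩
    have h2 : projIcc (0 : ℝ) 1 zero_le_one (τ x) = 0 := by rw [h1]; exact projIcc_left _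
    rw [h2, hζ0] at h
    linarith [h.1]

lemma exists_pos_lt_norm_of_isClosed {Y V : Type*} [TopologicalSpace Y] [CompactSpace Y]
    [NormedAddCommGroup V] (F : C(Y, V)) {A : Set Y} (hA : IsClosed A) (hF : ∀ a ∈ A, F a ≠ 0) :
    ∃ c > 0, ∀ a ∈ A, 2 * c ≤ ‖F a‖ := by
  rcases A.eq_empty_or_nonempty with rfl | hne
  · exact ⟨1, one_pos, by simp⟩
  · obtain ⟨w, hw, hmin⟩ := hA.isCompact.exists_isMinOn hne (f := fun a => ‖F a‖) (by fun_prop)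
    refine ⟨‖F w‖ / 2, half_pos (norm_pos_iff.2 (hF w hw)), fun a ha => ?_⟩
    have : ‖F w‖ ≤ ‖F a‖ := hmin ha
    linarith

lemma HasSeparatingPartitions.hasNonvanishingExt_of_rclike {Y 𝕜 : Type*} [MetricSpace Y]
    [CompactSpace Y] [RCLike 𝕜] {n : ℕ} (H : HasSeparatingPartitions Y (n + 2))
    (h𝕜 : Module.finrank ℝ 𝕜 = n + 1) : HasNonvanishingExt Y 𝕜 := by
  refine .of_approx fun F A hA hF => ?_
  obtain ⟨c, hc, hcF⟩ := exists_pos_lt_norm_of_isClosed F hA hF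
  obtain ⟨Φ, ζ, hΦ, hζI, hζ, hζ0, hζ1⟩ := H.exists_approx h𝕜 F hc
  obtain ⟨g, hg0, hg⟩ :=
    exists_nonvanishing_of_separated Φ ζ hζ (fun z => (hζI z).1) hζ0 hζ1 hc
  refine ⟨g, hg0, fun a ha => ?_⟩
  rw [hg a fun t => ?_]
  · linarith [hΦ (a, 0), hcF a ha]
  · have h1 : ‖Φ (a, t) - F a‖ < c := hΦ (a, t)
    have h2 := norm_sub_norm_le (F a) (Φ (a, t))
    rw [norm_sub_rev] at h2
    linarith [hcF a ha]

lemma HasSeparatingPartitions.hasNonvanishingExt {Y : Type*} [MetricSpace Y] [CompactSpace Y]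
    {n : ℕ} (H : HasSeparatingPartitions Y (n + 2)) :
    HasNonvanishingExt Y (Fin (n + 1) → ℝ) := by
  obtain rfl | rfl | hn : n = 0 ∨ n = 1 ∨ 2 ≤ n := by omega
  · exact (H.hasNonvanishingExt_of_rclike (𝕜 := ℝ) (by simp)).congr
      (ContinuousLinearEquiv.ofFinrankEq (by simp))
  · exact (H.hasNonvanishingExt_of_rclike (𝕜 := ℂ) (by simp)).congr
      (ContinuousLinearEquiv.ofFinrankEq (by simp))
  · refine .of_approx fun F A hA hF => ?_
    obtain ⟨c, hc, hcF⟩ := exists_pos_lt_norm_of_isClosed F hA hF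
    obtain ⟨Φ, ζ, hΦ, -, hζ, hζ0, hζ1⟩ := H.exists_approx (by simp) F hc
    obtain ⟨g, hg0, hg⟩ := H.exists_nonvanishing hn Φ ζ hζ hζ0 hζ1 hc
    refine ⟨g, hg0, fun a ha => ?_⟩
    obtain ⟨t, ht⟩ := hg a
    have h1 : ‖Φ (a, t) - F a‖ < c := hΦ (a, t)
    have h2 := norm_sub_le_norm_sub_add_norm_sub (g a) (Φ (a, t)) (F a)
    linarith [hcF a ha]

lemma AsdimLE.dimLE {T : Type*} [MetricSpace T] [CompactSpace T] {X : Set T} (hX : IsClosed X)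
    (hnd : IsNowhereDense X) {n : ℕ} (h : AsdimLE Xᶜ (n + 1)) : DimLE X (n : ℤ) := by
  rcases X.eq_empty_or_nonempty with he | hne
  · exact Or.inl ⟨isEmpty_coe_sort.2 he, by omega⟩
  have : CompactSpace X := isCompact_iff_compactSpace.1 hX.isCompact
  have H : HasSeparatingPartitions X (n + 2) := fun δ hδ => h.exists_partition hX hnd hne hδ
  exact H.hasNonvanishingExt.dimLE

/-- For a metrizable compactification pack `(X, X̂, X̃)` the following
are equivalent: (a) `dim X ≤ n`; (b) `asdim (X̂, ℰ₀) ≤ n + 1`; (c) every uniform cover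
of `X̂` is refined in a canonical cover of multiplicity at most `n + 2`; (d) every
canonical cover is refined in a canonical cover of multiplicity at most `n + 2`. -/
theorem statement0 {T : Type*} [MetricSpace T] [CompactSpace T]
    (X : Set T) (hXcl : IsClosed X) (hXnd : IsNowhereDense X) (n : ℕ) :
    (DimLE ↥X (n : ℤ) ↔ AsdimLE Xᶜ (n + 1)) ∧
    (DimLE ↥X (n : ℤ) ↔ ∀ β : Set (Set T), IsUniformCover Xᶜ β →
        ∃ α : Set (Set T), IsCanonicalCover X α ∧ Refines β α ∧ MultLE α (n + 2)) ∧
    (DimLE ↥X (n : ℤ) ↔ ∀ β : Set (Set T), IsCanonicalCover X β →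
        ∃ α : Set (Set T), IsCanonicalCover X α ∧ Refines β α ∧ MultLE α (n + 2)) := by
  have hac : DimLE ↥X (n : ℤ) → ∀ β, IsUniformCover Xᶜ β →
      ∃ α, IsCanonicalCover X α ∧ Refines β α ∧ MultLE α (n + 2) :=
    fun h β hβ => h.exists_canonical hXcl hβ
  have hcd : (∀ β, IsUniformCover Xᶜ β →
      ∃ α, IsCanonicalCover X α ∧ Refines β α ∧ MultLE α (n + 2)) → ∀ β, IsCanonicalCover X β →
      ∃ α, IsCanonicalCover X α ∧ Refines β α ∧ MultLE α (n + 2) :=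
    fun h β hβ => h β hβ.isUniformCover
  have hdb : (∀ β, IsCanonicalCover X β →
      ∃ α, IsCanonicalCover X α ∧ Refines β α ∧ MultLE α (n + 2)) → AsdimLE Xᶜ (n + 1) := by
    intro h β hβ
    obtain ⟨γ, hγ, hβγ⟩ := hβ.exists_canonical hXcl
    obtain ⟨α, hα, hγα, hm⟩ := h γ hγ
    exact ⟨α, hα.isUniformCover, hβγ.trans hγα, hm⟩
  have hba : AsdimLE Xᶜ (n + 1) → DimLE ↥X (n : ℤ) := fun h => h.dimLE hXcl hXnd
  exact ⟨⟨fun h => hdb (hcd (hac h)), hba⟩, ⟨hac, fun h => hba (hdb (hcd h))⟩,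
    ⟨fun h => hcd (hac h), fun h => hba (hdb h)⟩⟩
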